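/- Let c ∈ [1, 16/15), h ∈ F_c, and φ the inverse of h. Let K, L ∈ ℕ, m ∈ ℤ \ {0}, and assume |m| · min{K, L} ≤ σ(KL) φ(KL) and φ(KL) ≤ min{K, L}⁴, where σ(x) = ϑ(φ(x)) if c = 1 and σ ≡ 1 if c > 1. Let (Δ₁(l))_{l ∈ (L, 2L]} and (Δ₂(k))_{k ∈ (K, 2K]} be complex sequences with Σ_{L < l ≤ 2L} |Δ₁(l)|² ≲ L log³ L and Σ_{K < k ≤ 2K} |Δ₂(k)|² ≲ K log³ K. Then for every α ∈ ℝ, every 0 < P < P₁, every L' ∈ (L, 2L], and every K' ∈ (K, 2K]: |Σ_{L < l ≤ L'} Σ_{K < k ≤ K', P < kl ≤ P₁} Δ₁(l) Δ₂(k) e^{2πi(αkl + mφ(kl))}| ≲ |m|^{1/6} log² L · log² K · (σ(KL) φ(KL))^{−1/6} · min{K, L}^{1/6} · KL, where the implied constant depends only on h and the implied constants in the hypotheses on Δ₁, Δ₂. -/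

import Mathlib

open Filter Real Set
open scoped Classical

structure Fc (c : ℝ) where
  x₀ : ℝ
  one_le_x₀ : 1 ≤ x₀
  toFun : ℝ → ℝ
  vth : ℝ → ℝ
  Ch : ℝ
  Ch_pos : 0 < Ch
  one_le : ∀ x ≥ x₀, 1 ≤ toFun x
  contDiffOn : ContDiffOn ℝ 3 toFun (Set.Ici x₀)
  deriv_pos : ∀ x ≥ x₀, 0 < deriv toFun x
  deriv2_pos : ∀ x ≥ x₀, 0 < iteratedDeriv 2 toFun x
  vth_contDiffOn : ContDiffOn ℝ 2 vth (Set.Ici x₀)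
  eqn : ∀ x ≥ x₀, toFun x = Ch * x ^ c * Real.exp (∫ t in x₀..x, vth t / t)
  cond_gt : 1 < c →
    Filter.Tendsto vth Filter.atTop (nhds 0) ∧
    Filter.Tendsto (fun x => x * deriv vth x) Filter.atTop (nhds 0) ∧
    Filter.Tendsto (fun x => x ^ 2 * deriv (deriv vth) x) Filter.atTop (nhds 0)
  cond_eq : c = 1 →
    (∀ x ≥ x₀, 0 < vth x) ∧
    (∀ x y, x₀ ≤ x → x ≤ y → vth y ≤ vth x) ∧
    (∀ ε : ℝ, 0 < ε → ∃ C > 0, ∀ x ≥ x₀, 1 / vth x ≤ C * x ^ ε) ∧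
    Filter.Tendsto (fun x => x / toFun x) Filter.atTop (nhds 0) ∧
    Filter.Tendsto vth Filter.atTop (nhds 0) ∧
    Filter.Tendsto (fun x => x * deriv vth x / vth x) Filter.atTop (nhds 0) ∧
    Filter.Tendsto (fun x => x ^ 2 * deriv (deriv vth) x / vth x) Filter.atTop (nhds 0)

def Ph {c : ℝ} (F : Fc c) : Set ℕ :=
  {p : ℕ | p.Prime ∧ ∃ n : ℕ, F.x₀ ≤ (n : ℝ) ∧ (p : ℤ) = ⌊F.toFun n⌋}

noncomputable def e (t : ℝ) : ℂ := Complex.exp (2 * Real.pi * Complex.I * t)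

/-- The function `σ` of Lemma 2.4: `σ(x) = ϑ(φ(x))` when `c = 1`, and `σ ≡ 1` when `c > 1`. -/
noncomputable def sigmah {c : ℝ} (F : Fc c) (φ : ℝ → ℝ) (x : ℝ) : ℝ :=
  if c = 1 then F.vth (φ x) else 1



lemma e_add (s t : ℝ) : e (s + t) = e s * e t := by
  unfold e; rw [← Complex.exp_add]; congr 1; push_cast; ring

lemma e_eq (t : ℝ) : e t = Complex.exp (((2 * Real.pi * t : ℝ) : ℂ) * Complex.I) := by
  unfold e; congr 1; push_cast; ring

lemma norm_e (t : ℝ) : ‖e t‖ = 1 := by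
  rw [e_eq, Complex.norm_exp_ofReal_mul_I]

lemma e_int (j : ℤ) : e j = 1 := by
  unfold e
  rw [Complex.exp_eq_one_iff]
  exact ⟨j, by push_cast; ring⟩

lemma e_neg (t : ℝ) : e (-t) = (starRingEnd ℂ) (e t) := by
  rw [e_eq, e_eq, ← Complex.exp_conj, map_mul, Complex.conj_ofReal, Complex.conj_I]
  congr 1
  push_cast; ring

noncomputable def cotp (x : ℝ) : ℝ := Real.cos (Real.pi * x) / Real.sin (Real.pi * x)
noncomputable def Gp (x : ℝ) : ℂ := 1 / 2 + (cotp x / 2 : ℝ) * Complex.I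

lemma Gp_spec (x : ℝ) (h : Real.sin (Real.pi * x) ≠ 0) : Gp x * (1 - e x) = 1 := by
  have h2 : e x = ((Real.cos (Real.pi * x)) + (Real.sin (Real.pi * x)) * Complex.I) ^ 2 := by
    rw [e_eq]
    rw [show ((2 * Real.pi * x : ℝ) : ℂ) * Complex.I = (2 : ℕ) * (((Real.pi * x : ℝ) : ℂ) * Complex.I) by
      push_cast; ring, Complex.exp_nat_mul, Complex.exp_mul_I]
    simp
  rw [h2]
  unfold Gp cotp
  set a := Real.cos (Real.pi * x)
  set b := Real.sin (Real.pi * x)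
  have hab : (a : ℂ) ^ 2 + (b : ℂ) ^ 2 = 1 := by
    have := Real.cos_sq_add_sin_sq (Real.pi * x)
    exact_mod_cast this
  have hb : (b : ℂ) ≠ 0 := by exact_mod_cast h
  push_cast
  field_simp
  have hI := Complex.I_sq
  have h3 : (1 : ℂ) - (a + b * Complex.I) ^ 2 = 2 * b ^ 2 - 2 * a * b * Complex.I := by
    linear_combination - hab - (b : ℂ) ^ 2 * hI
  rw [h3]
  linear_combination 2 * b * hab - 2 * a ^ 2 * b * hI

lemma cotp_anti {x y : ℝ} (hx : 0 < x) (hxy : x ≤ y) (hy : y < 1) : cotp y ≤ cotp x := by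
  have hpi := Real.pi_pos
  have s1 : 0 < Real.sin (Real.pi * x) := Real.sin_pos_of_pos_of_lt_pi (by positivity) (by nlinarith)
  have s2 : 0 < Real.sin (Real.pi * y) :=
    Real.sin_pos_of_pos_of_lt_pi (mul_pos hpi (by linarith)) (by nlinarith)
  have s3 : 0 ≤ Real.sin (Real.pi * y - Real.pi * x) :=
    Real.sin_nonneg_of_nonneg_of_le_pi (by nlinarith) (by nlinarith)
  unfold cotp
  rw [div_le_div_iff₀ s2 s1]
  rw [Real.sin_sub] at s3
  nlinarith

lemma cotp_abs {δ x : ℝ} (hδ : 0 < δ) (hx : δ ≤ x) (hx1 : x ≤ 1 - δ) : |cotp x| ≤ 1 / (2 * δ) := by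
  have hpi := Real.pi_pos
  have key : 2 * δ ≤ Real.sin (Real.pi * x) := by
    rcases le_total x (1/2) with h | h
    · have := Real.mul_le_sin (x := Real.pi * x) (by nlinarith) (by nlinarith)
      have h2 : 2 / Real.pi * (Real.pi * x) = 2 * x := by field_simp
      linarith
    · have := Real.mul_le_sin (x := Real.pi * (1 - x)) (by nlinarith) (by nlinarith)
      have h2 : 2 / Real.pi * (Real.pi * (1 - x)) = 2 * (1 - x) := by field_simp
      rw [show Real.pi * (1 - x) = Real.pi - Real.pi * x by ring, Real.sin_pi_sub] at this
      have h3 : 2 / Real.pi * (Real.pi - Real.pi * x) = 2 * (1 - x) := by field_simp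
      linarith
  unfold cotp
  rw [abs_div, abs_of_pos (show 0 < Real.sin (Real.pi * x) by linarith)]
  apply div_le_div₀ (by norm_num) (Real.abs_cos_le_one _) (by linarith) key

lemma Gp_norm {δ x : ℝ} (hδ : 0 < δ) (hx : δ ≤ x) (hx1 : x ≤ 1 - δ) : ‖Gp x‖ ≤ 1 / δ := by
  have h := cotp_abs hδ hx hx1
  have hδ2 : δ ≤ 1 / 2 := by linarith
  unfold Gp
  calc _ ≤ ‖(1 / 2 : ℂ)‖ + ‖((cotp x / 2 : ℝ) : ℂ) * Complex.I‖ := norm_add_le _ _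
    _ ≤ 1 / 2 + 1 / (4 * δ) := by
        rw [norm_mul, Complex.norm_I, mul_one, Complex.norm_real, Real.norm_eq_abs, abs_div]
        norm_num
        have : 1 / (2 * δ) = 2 * (δ⁻¹ * 4⁻¹) := by field_simp; norm_num
        linarith
    _ ≤ 1 / δ := by
        rw [div_add_div _ _ (by norm_num) (by positivity), div_le_div_iff₀ (by positivity) hδ]
        nlinarith

lemma kusmin_landau (f : ℕ → ℝ) (a b : ℕ) (j : ℤ) (δ : ℝ) (hδ : 0 < δ)
    (h1 : ∀ n, a ≤ n → n < b → j + δ ≤ f (n + 1) - f n ∧ f (n + 1) - f n ≤ j + 1 - δ)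
    (h2 : ∀ n, a ≤ n → n + 1 < b → f (n + 1) - f n ≤ f (n + 2) - f (n + 1)) :
    ‖∑ n ∈ Finset.Ico a b, e (f n)‖ ≤ 3 / δ := by
  rcases le_or_gt b a with hab | hab
  · rw [Finset.Ico_eq_empty (by omega)]; simp; positivity
  set g : ℕ → ℝ := fun n => f (n + 1) - f n - j with hg
  have hg1 : ∀ n, a ≤ n → n < b → δ ≤ g n ∧ g n ≤ 1 - δ := by
    intro n h h'
    have := h1 n h h'
    constructor <;> simp only [hg] <;> linarith
  have hsin : ∀ n, a ≤ n → n < b → Real.sin (Real.pi * g n) ≠ 0 := by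
    intro n h h'
    have := hg1 n h h'
    have hpi := Real.pi_pos
    exact (Real.sin_pos_of_pos_of_lt_pi (mul_pos hpi (by linarith)) (by nlinarith)).ne'
  have hE : ∀ n, e (f (n + 1)) = e (f n) * e (g n) := by
    intro n
    have : f (n + 1) = f n + g n + (j : ℝ) := by simp only [hg]; ring
    rw [this, e_add, e_int, mul_one, e_add]
  have hE2 : ∀ n, a ≤ n → n < b → e (f n) = Gp (g n) * (e (f n) - e (f (n + 1))) := by
    intro n h h'
    rw [hE]
    linear_combination (- e (f n)) * Gp_spec (g n) (hsin n h h')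
  have claim : ∀ d, a + d < b →
      ‖∑ i ∈ Finset.Ico a (a + d + 1), e (f i) + Gp (g (a + d)) * e (f (a + d + 1))‖
        ≤ 1 / δ + (cotp (g a) - cotp (g (a + d))) / 2 := by
    intro d
    induction d with
    | zero =>
      intro h
      have := hE2 a le_rfl h
      simp only [add_zero, Nat.Ico_succ_singleton, Finset.sum_singleton, sub_self, zero_div]
      have h3 : e (f a) + Gp (g a) * e (f (a + 1)) = Gp (g a) * e (f a) := by
        linear_combination this
      rw [h3, norm_mul, norm_e, mul_one]
      exact Gp_norm hδ (hg1 a le_rfl h).1 (hg1 a le_rfl h).2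
    | succ d ih =>
      intro h
      have ih := ih (by omega)
      have h4 := hE2 (a + d + 1) (by omega) (by omega)
      rw [show a + (d + 1) = a + d + 1 by ring]
      rw [Finset.sum_Ico_succ_top (by omega)]
      have h5 : ∑ i ∈ Finset.Ico a (a + d + 1), e (f i) + e (f (a + d + 1)) +
          Gp (g (a + d + 1)) * e (f (a + d + 1 + 1)) =
          (∑ i ∈ Finset.Ico a (a + d + 1), e (f i) + Gp (g (a + d)) * e (f (a + d + 1))) +
          (Gp (g (a + d + 1)) - Gp (g (a + d))) * e (f (a + d + 1)) := by
        linear_combination h4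
      rw [h5]
      have h6 : ‖Gp (g (a + d + 1)) - Gp (g (a + d))‖ =
          (cotp (g (a + d)) - cotp (g (a + d + 1))) / 2 := by
        unfold Gp
        have h7 : cotp (g (a + d + 1)) ≤ cotp (g (a + d)) := by
          apply cotp_anti
          · linarith [(hg1 (a + d) (by omega) (by omega)).1]
          · have := h2 (a + d) (by omega) (by omega)
            simp only [hg]
            linarith
          · linarith [(hg1 (a + d + 1) (by omega) (by omega)).2]
        have h8 : (1 / 2 + ((cotp (g (a + d + 1)) / 2 : ℝ) : ℂ) * Complex.I - (1 / 2 + ((cotp (g (a + d)) / 2 : ℝ) : ℂ) * Complex.I))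
          = (((cotp (g (a + d + 1)) - cotp (g (a + d))) / 2 : ℝ) : ℂ) * Complex.I := by
          push_cast; ring
        rw [h8, norm_mul, Complex.norm_I, mul_one, Complex.norm_real, Real.norm_eq_abs, abs_of_nonpos]
        · ring
        · linarith
      refine (norm_add_le _ _).trans ?_
      rw [norm_mul, norm_e, mul_one, h6]
      linarith
  have hc := claim (b - 1 - a) (by omega)
  have hb1 : a + (b - 1 - a) = b - 1 := by omega
  have hb2 : b - 1 + 1 = b := by omega
  rw [hb1, hb2] at hc
  have g1 := hg1 (b - 1) (by omega) (by omega)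
  have g2 := hg1 a le_rfl hab
  have c1 := abs_le.1 (cotp_abs hδ g1.1 g1.2)
  have c2 := abs_le.1 (cotp_abs hδ g2.1 g2.2)
  have n1 := Gp_norm hδ g1.1 g1.2
  have : ‖∑ n ∈ Finset.Ico a b, e (f n)‖ ≤ ‖∑ i ∈ Finset.Ico a b, e (f i) + Gp (g (b - 1)) * e (f b)‖ + ‖Gp (g (b - 1)) * e (f b)‖ := by
    have := norm_sub_le (∑ i ∈ Finset.Ico a b, e (f i) + Gp (g (b - 1)) * e (f b)) (Gp (g (b - 1)) * e (f b))
    simpa using this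
  rw [norm_mul, norm_e, mul_one] at this
  have h9 : 1 / (2 * δ) = 1 / δ / 2 := by field_simp
  have h10 : 3 / δ = 1 / δ + 1 / δ + 1 / δ := by field_simp; norm_num
  have h11 : 0 < 1 / δ := by positivity
  linarith

lemma ordConn_finset (J : Finset ℕ) (h : ∀ x ∈ J, ∀ y ∈ J, ∀ z, x ≤ z → z ≤ y → z ∈ J) :
    ∃ a b, J = Finset.Ico a b := by
  rcases J.eq_empty_or_nonempty with rfl | hne
  · exact ⟨0, 0, by simp⟩
  · refine ⟨J.min' hne, J.max' hne + 1, ?_⟩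
    ext x
    simp only [Finset.mem_Ico]
    constructor
    · intro hx
      exact ⟨Finset.min'_le _ _ hx, Nat.lt_succ_of_le (Finset.le_max' _ _ hx)⟩
    · rintro ⟨h1, h2⟩
      exact h _ (Finset.min'_mem _ _) _ (Finset.max'_mem _ hne) _ h1 (Nat.le_of_lt_succ h2)

/-- number of points of a `lam`-separated sequence in an interval -/
lemma sep_card (g : ℕ → ℝ) (J : Finset ℕ) (lam δ y : ℝ) (hl : 0 < lam) (hδ : 0 ≤ δ)
    (hg : ∀ x ∈ J, ∀ z ∈ J, x ≤ z → lam * ((z : ℝ) - x) ≤ g z - g x)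
    (hy : ∀ x ∈ J, y ≤ g x ∧ g x ≤ y + δ) : (J.card : ℝ) ≤ δ / lam + 1 := by
  rcases J.eq_empty_or_nonempty with rfl | hne
  · simp; positivity
  have hsub : J ⊆ Finset.Icc (J.min' hne) (J.max' hne) := by
    intro x hx
    simp only [Finset.mem_Icc]
    exact ⟨Finset.min'_le _ _ hx, Finset.le_max' _ _ hx⟩
  have h1 := Finset.card_le_card hsub
  have hmm : J.min' hne ≤ J.max' hne := Finset.min'_le_max' _ _
  rw [Nat.card_Icc] at h1
  have h2 : (J.card : ℝ) ≤ (J.max' hne : ℝ) + 1 - (J.min' hne : ℝ) := by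
    have : J.card + J.min' hne ≤ J.max' hne + 1 := by omega
    have : (J.card : ℝ) + J.min' hne ≤ J.max' hne + 1 := by exact_mod_cast this
    linarith
  have h3 := hg _ (Finset.min'_mem _ hne) _ (Finset.max'_mem _ hne) hmm
  have h4 := hy _ (Finset.min'_mem _ hne)
  have h5 := hy _ (Finset.max'_mem _ hne)
  have h6 : (J.max' hne : ℝ) - (J.min' hne : ℝ) ≤ δ / lam := by
    rw [le_div_iff₀ hl]; linarith
  linarith

lemma vdc_aux (f : ℕ → ℝ) (a b : ℕ) (lam A : ℝ) (hl : 0 < lam) (hA : 1 ≤ A)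
    (h : ∀ n, a ≤ n → n < b → lam ≤ f (n + 2) - 2 * f (n + 1) + f n ∧
      f (n + 2) - 2 * f (n + 1) + f n ≤ A * lam) :
    ‖∑ n ∈ Finset.Ico a b, e (f n)‖ ≤ 16 * A * (((b - a : ℕ) : ℝ) * √lam + 1 / √lam) := by
  rcases le_or_gt b a with hab | hab
  · rw [Finset.Ico_eq_empty (by omega)]
    simp only [Finset.sum_empty, norm_zero]; positivity
  have triv : ‖∑ n ∈ Finset.Ico a b, e (f n)‖ ≤ ((b - a : ℕ) : ℝ) := by
    refine (norm_sum_le _ _).trans ?_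
    simp [norm_e]
  have hs : 0 < √lam := Real.sqrt_pos.2 hl
  set δ := √lam with hδ
  have hδ2 : δ * δ = lam := Real.mul_self_sqrt hl.le
  have hn0 : (0 : ℝ) ≤ ((b - a : ℕ) : ℝ) := Nat.cast_nonneg _
  rcases le_or_gt (1/2) δ with hbig | hsmall
  · refine triv.trans ?_
    have h1 : 0 < 1 / δ := by positivity
    have h2 : ((b - a : ℕ) : ℝ) ≤ 2 * (((b - a : ℕ) : ℝ) * δ) := by nlinarith
    have h3 : 0 ≤ ((b - a : ℕ) : ℝ) * δ := by positivity
    nlinarith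
  set g : ℕ → ℝ := fun n => f (n + 1) - f n with hg
  have ginc : ∀ d n, a ≤ n → n + d < b + 1 → lam * d ≤ g (n + d) - g n ∧ g (n + d) - g n ≤ A * lam * d := by
    intro d n hn
    induction d with
    | zero => intro _; simp
    | succ d ih =>
      intro hd
      have ih := ih (by omega)
      have := h (n + d) (by omega) (by omega)
      have e1 : g (n + (d + 1)) - g (n + d) = f (n + d + 2) - 2 * f (n + d + 1) + f (n + d) := by
        simp only [hg]
        rw [show n + (d + 1) + 1 = n + d + 2 by ring, show n + (d + 1) = n + d + 1 by ring]
        ring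
      push_cast
      constructor <;> nlinarith [this.1, this.2, ih.1, ih.2]
  have gsep : ∀ x ∈ Finset.Ico a b, ∀ z ∈ Finset.Ico a b, x ≤ z → lam * ((z : ℝ) - x) ≤ g z - g x := by
    intro x hx z hz hxz
    rw [Finset.mem_Ico] at hx hz
    have := (ginc (z - x) x hx.1 (by omega)).1
    rw [show x + (z - x) = z by omega] at this
    rwa [Nat.cast_sub hxz] at this
  have gmono : ∀ x ∈ Finset.Ico a b, ∀ z ∈ Finset.Ico a b, x ≤ z → g x ≤ g z := by
    intro x hx z hz hxz
    have := gsep x hx z hz hxz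
    have h2 : (0:ℝ) ≤ (z : ℝ) - x := by
      have : (x : ℝ) ≤ z := by exact_mod_cast hxz
      linarith
    nlinarith [mul_nonneg hl.le h2]
  set J : Finset ℤ := Finset.Icc ⌊g a⌋ ⌊g (b - 1)⌋ with hJ
  have hmap : ∀ n ∈ Finset.Ico a b, ⌊g n⌋ ∈ J := by
    intro n hn
    have hn' := Finset.mem_Ico.1 hn
    rw [hJ, Finset.mem_Icc]
    constructor
    · exact Int.floor_le_floor (gmono a (by simp [hab]) n hn hn'.1)
    · exact Int.floor_le_floor (gmono n hn (b - 1) (by simp; omega) (by omega))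
  rw [← Finset.sum_fiberwise_of_maps_to hmap]
  have hfib : ∀ j ∈ J, ‖∑ n ∈ Finset.Ico a b with ⌊g n⌋ = j, e (f n)‖ ≤ 7 / δ := by
    intro j _
    set I := (Finset.Ico a b).filter (fun n => ⌊g n⌋ = j)
    have hI : ∀ n ∈ I, n ∈ Finset.Ico a b ∧ (j : ℝ) ≤ g n ∧ g n < j + 1 := by
      intro n hn
      rw [Finset.mem_filter] at hn
      exact ⟨hn.1, (Int.floor_eq_iff.1 hn.2)⟩
    have hI' : ∀ n ∈ Finset.Ico a b, (j : ℝ) ≤ g n → g n < j + 1 → n ∈ I := by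
      intro n hn h1 h2
      rw [Finset.mem_filter]
      exact ⟨hn, Int.floor_eq_iff.2 ⟨h1, h2⟩⟩
    rw [← Finset.sum_filter_add_sum_filter_not I (fun n => g n < j + δ)]
    rw [← Finset.sum_filter_add_sum_filter_not (I.filter (fun n => ¬ g n < j + δ)) (fun n => g n ≤ j + 1 - δ)]
    have cardb : ∀ (S : Finset ℕ) (y : ℝ), S ⊆ Finset.Ico a b → (∀ x ∈ S, y ≤ g x ∧ g x ≤ y + δ) →
        ‖∑ n ∈ S, e (f n)‖ ≤ 2 / δ := by
      intro S y hS hy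
      have h1 : ‖∑ n ∈ S, e (f n)‖ ≤ S.card := by
        refine (norm_sum_le _ _).trans ?_
        simp [norm_e]
      have h2 := sep_card g S lam δ y hl hs.le (fun x hx z hz => gsep x (hS hx) z (hS hz)) hy
      have h3 : δ / lam = 1 / δ := by rw [← hδ2]; field_simp
      have h4 : 1 ≤ 1 / δ := by rw [le_div_iff₀ hs]; linarith
      have h5 : 2 / δ = 1 / δ + 1 / δ := by field_simp; norm_num
      linarith
    have b1 := cardb (I.filter (fun n => g n < j + δ)) j
      (fun n hn => (hI n (Finset.mem_filter.1 hn).1).1) (fun n hn => by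
        have h1 := Finset.mem_filter.1 hn
        have h2 := hI n h1.1
        exact ⟨h2.2.1, h1.2.le⟩)
    have b2 := cardb ((I.filter (fun n => ¬ g n < j + δ)).filter (fun n => ¬ g n ≤ j + 1 - δ)) (j + 1 - δ)
      (fun n hn => (hI n (Finset.mem_filter.1 (Finset.mem_filter.1 hn).1).1).1) (fun n hn => by
        have h1 := Finset.mem_filter.1 hn
        have h2 := hI n (Finset.mem_filter.1 h1.1).1
        exact ⟨(not_le.1 h1.2).le, by linarith [h2.2.2]⟩)
    have b3 : ‖∑ n ∈ (I.filter (fun n => ¬ g n < j + δ)).filter (fun n => g n ≤ j + 1 - δ), e (f n)‖ ≤ 3 / δ := by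
      set M := (I.filter (fun n => ¬ g n < j + δ)).filter (fun n => g n ≤ j + 1 - δ)
      have hM : ∀ n, n ∈ M ↔ n ∈ Finset.Ico a b ∧ j + δ ≤ g n ∧ g n ≤ j + 1 - δ := by
        intro n
        constructor
        · intro hn
          have h1 := Finset.mem_filter.1 hn
          have h2 := Finset.mem_filter.1 h1.1
          exact ⟨(hI n h2.1).1, not_lt.1 h2.2, h1.2⟩
        · rintro ⟨h1, h2, h3⟩
          rw [Finset.mem_filter, Finset.mem_filter]
          exact ⟨⟨hI' n h1 (by linarith) (by linarith), not_lt.2 h2⟩, h3⟩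
      obtain ⟨a', b', hab'⟩ := ordConn_finset M (by
        intro x hx y hy z hxz hzy
        rw [hM] at hx hy ⊢
        have hz : z ∈ Finset.Ico a b := by
          have := Finset.mem_Ico.1 hx.1
          have := Finset.mem_Ico.1 hy.1
          rw [Finset.mem_Ico]; omega
        exact ⟨hz, hx.2.1.trans (gmono x hx.1 z hz hxz), (gmono z hz y hy.1 hzy).trans hy.2.2⟩)
      rw [hab']
      apply kusmin_landau f a' b' j δ hs
      · intro n h1 h2
        have : n ∈ M := by rw [hab', Finset.mem_Ico]; exact ⟨h1, h2⟩
        exact ((hM n).1 this).2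
      · intro n h1 h2
        have m1 : n ∈ M := by rw [hab', Finset.mem_Ico]; omega
        have m2 : n + 1 ∈ M := by rw [hab', Finset.mem_Ico]; omega
        exact gmono n ((hM n).1 m1).1 (n + 1) ((hM _).1 m2).1 (by omega)
    have t1 := norm_add_le (∑ n ∈ I.filter (fun n => g n < j + δ), e (f n))
      (∑ n ∈ (I.filter (fun n => ¬ g n < j + δ)).filter (fun n => g n ≤ j + 1 - δ), e (f n) +
        ∑ n ∈ (I.filter (fun n => ¬ g n < j + δ)).filter (fun n => ¬ g n ≤ j + 1 - δ), e (f n))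
    have t2 := norm_add_le (∑ n ∈ (I.filter (fun n => ¬ g n < j + δ)).filter (fun n => g n ≤ j + 1 - δ), e (f n))
      (∑ n ∈ (I.filter (fun n => ¬ g n < j + δ)).filter (fun n => ¬ g n ≤ j + 1 - δ), e (f n))
    have h7 : 7 / δ = 2 / δ + 3 / δ + 2 / δ := by field_simp; norm_num
    linarith
  refine (norm_sum_le _ _).trans ((Finset.sum_le_sum hfib).trans ?_)
  rw [Finset.sum_const, nsmul_eq_mul]
  have hcard : (J.card : ℝ) ≤ A * lam * ((b - a : ℕ) : ℝ) + 2 := by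
    rw [hJ, Int.card_Icc]
    have hle : ⌊g a⌋ ≤ ⌊g (b - 1)⌋ := Int.floor_le_floor (gmono a (by simp [hab]) (b - 1) (by simp; omega) (by omega))
    have h1 : (((⌊g (b - 1)⌋ + 1 - ⌊g a⌋).toNat : ℕ) : ℝ) = (⌊g (b - 1)⌋ : ℝ) + 1 - ⌊g a⌋ := by
      have : (((⌊g (b - 1)⌋ + 1 - ⌊g a⌋).toNat : ℕ) : ℤ) = ⌊g (b - 1)⌋ + 1 - ⌊g a⌋ := Int.toNat_of_nonneg (by omega)
      exact_mod_cast this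
    rw [h1]
    have h2 := Int.floor_le (g (b - 1))
    have h3 := Int.lt_floor_add_one (g a)
    have h4 := (ginc (b - 1 - a) a le_rfl (by omega)).2
    rw [show a + (b - 1 - a) = b - 1 by omega] at h4
    have h5 : ((b - 1 - a : ℕ) : ℝ) ≤ ((b - a : ℕ) : ℝ) := by exact_mod_cast (by omega : b - 1 - a ≤ b - a)
    have h6 : A * lam * ((b - 1 - a : ℕ) : ℝ) ≤ A * lam * ((b - a : ℕ) : ℝ) := by
      apply mul_le_mul_of_nonneg_left h5; positivity
    linarith
  calc (J.card : ℝ) * (7 / δ) ≤ (A * lam * ((b - a : ℕ) : ℝ) + 2) * (7 / δ) := by gcongr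
    _ = 7 * A * (((b - a : ℕ) : ℝ) * δ) + 14 * (1 / δ) := by rw [← hδ2]; field_simp; ring
    _ ≤ _ := by
      have h1 : 0 < 1 / δ := by positivity
      have h3 : 0 ≤ A * (((b - a : ℕ) : ℝ) * δ) := by positivity
      nlinarith

lemma vdc (f : ℕ → ℝ) (J : Finset ℕ) (K : ℕ) (lam A ε : ℝ) (hl : 0 < lam) (hA : 1 ≤ A)
    (hε : ε = 1 ∨ ε = -1)
    (hJc : ∀ x ∈ J, ∀ y ∈ J, ∀ z, x ≤ z → z ≤ y → z ∈ J) (hK : J.card ≤ K)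
    (h : ∀ n ∈ J, lam ≤ ε * (f (n + 2) - 2 * f (n + 1) + f n) ∧
      ε * (f (n + 2) - 2 * f (n + 1) + f n) ≤ A * lam) :
    ‖∑ n ∈ J, e (f n)‖ ≤ 16 * A * ((K : ℝ) * √lam + 1 / √lam) := by
  obtain ⟨a, b, rfl⟩ := ordConn_finset J hJc
  rw [Nat.card_Ico] at hK
  have hK' : ((b - a : ℕ) : ℝ) ≤ K := by exact_mod_cast hK
  have key : ‖∑ n ∈ Finset.Ico a b, e (f n)‖ = ‖∑ n ∈ Finset.Ico a b, e (ε * f n)‖ := by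
    rcases hε with rfl | rfl
    · simp
    · have : ∑ n ∈ Finset.Ico a b, e (-1 * f n) = (starRingEnd ℂ) (∑ n ∈ Finset.Ico a b, e (f n)) := by
        rw [map_sum]
        refine Finset.sum_congr rfl fun n _ => ?_
        rw [← e_neg]; ring_nf
      rw [this, RCLike.norm_conj]
  rw [key]
  refine (vdc_aux (fun n => ε * f n) a b lam A hl hA ?_).trans ?_
  · intro n h1 h2
    have := h n (Finset.mem_Ico.2 ⟨h1, h2⟩)
    constructor <;> nlinarith [this.1, this.2]
  · gcongr

lemma block_sq (B Ks : Finset ℕ) (H : ℕ) (a : ℕ → ℂ) (w : ℕ → ℕ → ℂ) (U : ℝ) (hU : 0 ≤ U)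
    (hB : B.card ≤ H)
    (hw : ∀ l ∈ B, ∀ k ∈ Ks, ‖w l k‖ ≤ 1)
    (hoff : ∀ l ∈ B, ∀ l' ∈ B, l ≠ l' → ‖∑ k ∈ Ks, w l k * (starRingEnd ℂ) (w l' k)‖ ≤ U) :
    ∑ k ∈ Ks, ‖∑ l ∈ B, a l * w l k‖ ^ 2 ≤ (∑ l ∈ B, ‖a l‖ ^ 2) * (Ks.card + H * U) := by
  have h1 : ((∑ k ∈ Ks, ‖∑ l ∈ B, a l * w l k‖ ^ 2 : ℝ) : ℂ) =
      ∑ l ∈ B, ∑ l' ∈ B, a l * (starRingEnd ℂ) (a l') * ∑ k ∈ Ks, w l k * (starRingEnd ℂ) (w l' k) := by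
    push_cast
    have : ∀ k ∈ Ks, ((‖∑ l ∈ B, a l * w l k‖ : ℝ) : ℂ) ^ 2 =
        ∑ l ∈ B, ∑ l' ∈ B, a l * (starRingEnd ℂ) (a l') * (w l k * (starRingEnd ℂ) (w l' k)) := by
      intro k _
      rw [← Complex.mul_conj', map_sum, Finset.sum_mul_sum]
      refine Finset.sum_congr rfl fun l _ => Finset.sum_congr rfl fun l' _ => ?_
      rw [map_mul]; ring
    rw [Finset.sum_congr rfl this, Finset.sum_comm]
    refine Finset.sum_congr rfl fun l _ => ?_
    rw [Finset.sum_comm]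
    refine Finset.sum_congr rfl fun l' _ => ?_
    rw [Finset.mul_sum]
  have h2 : ∑ k ∈ Ks, ‖∑ l ∈ B, a l * w l k‖ ^ 2 = ‖((∑ k ∈ Ks, ‖∑ l ∈ B, a l * w l k‖ ^ 2 : ℝ) : ℂ)‖ := by
    rw [Complex.norm_real, Real.norm_eq_abs, abs_of_nonneg]
    positivity
  rw [h2, h1]
  have h3 : ∀ l ∈ B, ∀ l' ∈ B, ‖a l * (starRingEnd ℂ) (a l') * ∑ k ∈ Ks, w l k * (starRingEnd ℂ) (w l' k)‖
      ≤ (if l = l' then ‖a l‖ ^ 2 * Ks.card else 0) + (‖a l‖ ^ 2 * (U / 2) + ‖a l'‖ ^ 2 * (U / 2)) := by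
    intro l hl l' hl'
    rw [norm_mul, norm_mul, RCLike.norm_conj]
    split_ifs with hll
    · subst hll
      have : ‖∑ k ∈ Ks, w l k * (starRingEnd ℂ) (w l k)‖ ≤ Ks.card := by
        refine (norm_sum_le _ _).trans ?_
        have : ∀ k ∈ Ks, ‖w l k * (starRingEnd ℂ) (w l k)‖ ≤ 1 := by
          intro k hk
          rw [norm_mul, RCLike.norm_conj]
          have := hw l hl k hk
          nlinarith [norm_nonneg (w l k)]
        simpa using Finset.sum_le_sum this
      have h5 : 0 ≤ ‖a l‖ * ‖a l‖ := by positivity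
      have := mul_le_mul_of_nonneg_left this h5
      have h6 : 0 ≤ ‖a l‖ ^ 2 * (U / 2) := by positivity
      nlinarith
    · have := hoff l hl l' hl' hll
      have h5 : 0 ≤ ‖a l‖ * ‖a l'‖ := by positivity
      have h6 := mul_le_mul_of_nonneg_left this h5
      have h7 := mul_nonneg (sq_nonneg (‖a l‖ - ‖a l'‖)) hU
      nlinarith
  calc _ ≤ ∑ l ∈ B, ∑ l' ∈ B, ((if l = l' then ‖a l‖ ^ 2 * Ks.card else 0) + (‖a l‖ ^ 2 * (U / 2) + ‖a l'‖ ^ 2 * (U / 2))) := by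
        refine (norm_sum_le _ _).trans (Finset.sum_le_sum fun l hl => ?_)
        exact (norm_sum_le _ _).trans (Finset.sum_le_sum fun l' hl' => h3 l hl l' hl')
    _ = (∑ l ∈ B, ‖a l‖ ^ 2) * (Ks.card + B.card * U) := by
        simp only [Finset.sum_add_distrib, Finset.sum_ite_eq, Finset.sum_const, nsmul_eq_mul, ← Finset.sum_mul, ← Finset.mul_sum]
        have : ∑ x ∈ B, (if x ∈ B then ‖a x‖ ^ 2 * (Ks.card : ℝ) else 0) = (∑ x ∈ B, ‖a x‖ ^ 2) * Ks.card := by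
          rw [Finset.sum_mul]
          exact Finset.sum_congr rfl fun x hx => by simp [hx]
        rw [this]; ring
    _ ≤ _ := by
        have : (B.card : ℝ) ≤ H := by exact_mod_cast hB
        gcongr

lemma bilinear_block (K L H : ℕ) (hH : 1 ≤ H) (a b : ℕ → ℂ) (w : ℕ → ℕ → ℂ) (U : ℝ) (hU : 0 ≤ U)
    (hw : ∀ l k, ‖w l k‖ ≤ 1)
    (hoff : ∀ l ∈ Finset.Ioc L (2 * L), ∀ l' ∈ Finset.Ioc L (2 * L), l < l' → l' - l < H →
      ‖∑ k ∈ Finset.Ioc K (2 * K), w l k * (starRingEnd ℂ) (w l' k)‖ ≤ U) :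
    ‖∑ l ∈ Finset.Ioc L (2 * L), ∑ k ∈ Finset.Ioc K (2 * K), a l * b k * w l k‖ ^ 2 ≤
      (∑ k ∈ Finset.Ioc K (2 * K), ‖b k‖ ^ 2) * (((L : ℝ) / H + 2) *
        ((∑ l ∈ Finset.Ioc L (2 * L), ‖a l‖ ^ 2) * (K + H * U))) := by
  set Ls := Finset.Ioc L (2 * L)
  set Ks := Finset.Ioc K (2 * K)
  have hKs : (Ks.card : ℝ) = K := by
    have : Ks.card = K := by rw [Nat.card_Ioc]; omega
    rw [this]
  have hoff' : ∀ l ∈ Ls, ∀ l' ∈ Ls, l ≠ l' → l / H = l' / H →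
      ‖∑ k ∈ Ks, w l k * (starRingEnd ℂ) (w l' k)‖ ≤ U := by
    intro l hl l' hl' hne hd
    have m1 := Nat.div_add_mod l H
    have m2 := Nat.div_add_mod l' H
    rw [hd] at m1
    have m3 := Nat.mod_lt l hH
    have m4 := Nat.mod_lt l' hH
    rcases lt_or_gt_of_ne hne with h | h
    · exact hoff l hl l' hl' h (by omega)
    · have := hoff l' hl' l hl h (by omega)
      rw [← RCLike.norm_conj, map_sum] at this
      refine le_trans (le_of_eq ?_) this
      congr 1
      refine Finset.sum_congr rfl fun k _ => ?_
      rw [map_mul, Complex.conj_conj, mul_comm]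
  set J := Finset.Icc (L / H) (2 * L / H)
  have hmap : ∀ l ∈ Ls, l / H ∈ J := by
    intro l hl
    have := Finset.mem_Ioc.1 hl
    rw [Finset.mem_Icc]
    exact ⟨Nat.div_le_div_right this.1.le, Nat.div_le_div_right this.2⟩
  have hJ : (J.card : ℝ) ≤ (L : ℝ) / H + 2 := by
    have hH0 : (0 : ℝ) < H := by exact_mod_cast hH
    rw [Nat.card_Icc]
    have hle : L / H ≤ 2 * L / H := Nat.div_le_div_right (by omega)
    rw [Nat.cast_sub (by omega)]
    push_cast
    have h1 : ((2 * L / H : ℕ) : ℝ) ≤ 2 * L / H := by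
      have := @Nat.cast_div_le ℝ _ _ _ (2 * L) H
      push_cast at this; exact this
    have h2 : (L : ℝ) / H ≤ ((L / H : ℕ) : ℝ) + 1 := by
      rw [div_le_iff₀ hH0]
      have m1 := Nat.div_add_mod L H
      have m3 := Nat.mod_lt L hH
      have : L ≤ (L / H + 1) * H := by nlinarith
      exact_mod_cast this
    have h3 : (2 * (L : ℝ) / H) = L / H + L / H := by ring
    linarith
  have h1 : ∑ l ∈ Ls, ∑ k ∈ Ks, a l * b k * w l k = ∑ k ∈ Ks, b k * ∑ l ∈ Ls, a l * w l k := by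
    rw [Finset.sum_comm]
    refine Finset.sum_congr rfl fun k _ => ?_
    rw [Finset.mul_sum]
    exact Finset.sum_congr rfl fun l _ => by ring
  rw [h1]
  have h2 : ‖∑ k ∈ Ks, b k * ∑ l ∈ Ls, a l * w l k‖ ^ 2 ≤
      (∑ k ∈ Ks, ‖b k‖ ^ 2) * ∑ k ∈ Ks, ‖∑ l ∈ Ls, a l * w l k‖ ^ 2 := by
    have h3 : ‖∑ k ∈ Ks, b k * ∑ l ∈ Ls, a l * w l k‖ ≤ ∑ k ∈ Ks, ‖b k‖ * ‖∑ l ∈ Ls, a l * w l k‖ := by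
      refine (norm_sum_le _ _).trans (le_of_eq ?_)
      exact Finset.sum_congr rfl fun k _ => norm_mul _ _
    exact (pow_le_pow_left₀ (norm_nonneg _) h3 2).trans (Finset.sum_mul_sq_le_sq_mul_sq _ _ _)
  refine h2.trans ?_
  apply mul_le_mul_of_nonneg_left _ (by positivity)
  have h4 : ∀ k ∈ Ks, ‖∑ l ∈ Ls, a l * w l k‖ ^ 2 ≤ (J.card : ℝ) * ∑ j ∈ J, ‖∑ l ∈ Ls with l / H = j, a l * w l k‖ ^ 2 := by
    intro k _
    rw [← Finset.sum_fiberwise_of_maps_to hmap]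
    refine (pow_le_pow_left₀ (norm_nonneg _) (norm_sum_le _ _) 2).trans ?_
    exact sq_sum_le_card_mul_sum_sq
  refine (Finset.sum_le_sum h4).trans ?_
  rw [← Finset.mul_sum, Finset.sum_comm]
  have h5 : ∀ j ∈ J, ∑ k ∈ Ks, ‖∑ l ∈ Ls with l / H = j, a l * w l k‖ ^ 2 ≤
      (∑ l ∈ Ls with l / H = j, ‖a l‖ ^ 2) * (K + H * U) := by
    intro j _
    rw [← hKs]
    apply block_sq _ _ _ _ _ _ hU
    · have : (Ls.filter (fun l => l / H = j)) ⊆ Finset.Ico (j * H) (j * H + H) := by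
        intro l hl
        have := (Finset.mem_filter.1 hl).2
        have m1 := Nat.div_add_mod l H
        have m3 := Nat.mod_lt l hH
        rw [Finset.mem_Ico]
        rw [this] at m1
        rw [mul_comm H j] at m1
        omega
      have := Finset.card_le_card this
      simpa using this
    · intro l _ k _; exact hw l k
    · intro l hl l' hl' hne
      have a1 := Finset.mem_filter.1 hl
      have a2 := Finset.mem_filter.1 hl'
      exact hoff' l a1.1 l' a2.1 hne (a1.2.trans a2.2.symm)
  have h6 := Finset.sum_le_sum h5
  rw [← Finset.sum_mul, Finset.sum_fiberwise_of_maps_to hmap] at h6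
  have h7 : 0 ≤ (∑ l ∈ Ls, ‖a l‖ ^ 2) * (K + H * U) := by positivity
  calc _ ≤ (J.card : ℝ) * ((∑ l ∈ Ls, ‖a l‖ ^ 2) * (K + H * U)) := by gcongr
    _ ≤ _ := by gcongr

namespace Fc
variable {c : ℝ} (F : Fc c)

lemma vth_hasDeriv {u : ℝ} (hu : F.x₀ < u) : HasDerivAt F.vth (deriv F.vth u) u := by
  have h := (F.vth_contDiffOn.contDiffAt (Ici_mem_nhds hu)).differentiableAt (by norm_num)
  exact h.hasDerivAt

lemma vth_hasDeriv2 {u : ℝ} (hu : F.x₀ < u) :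
    HasDerivAt (deriv F.vth) (deriv (deriv F.vth) u) u := by
  have h1 : ContDiffOn ℝ 2 F.vth (Set.Ioi F.x₀) := F.vth_contDiffOn.mono Set.Ioi_subset_Ici_self
  have h2 : ContDiffOn ℝ 1 (deriv F.vth) (Set.Ioi F.x₀) :=
    h1.deriv_of_isOpen isOpen_Ioi (by norm_num)
  exact ((h2.contDiffAt (Ioi_mem_nhds hu)).differentiableAt (by norm_num)).hasDerivAt

lemma x₀_pos : 0 < F.x₀ := lt_of_lt_of_le one_pos F.one_le_x₀

lemma hasDeriv {u : ℝ} (hu : F.x₀ < u) :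
    HasDerivAt F.toFun (F.toFun u * (c + F.vth u) / u) u := by
  have hu0 : 0 < u := F.x₀_pos.trans hu
  have hcont : ContinuousOn (fun t => F.vth t / t) (Set.Ici F.x₀) := by
    apply F.vth_contDiffOn.continuousOn.div continuousOn_id
    intro x hx
    exact (F.x₀_pos.trans_le hx).ne'
  have hint : IntervalIntegrable (fun t => F.vth t / t) MeasureTheory.volume F.x₀ u := by
    apply ContinuousOn.intervalIntegrable
    apply hcont.mono
    rw [Set.uIcc_of_le hu.le]
    exact Set.Icc_subset_Ici_self
  have hI : HasDerivAt (fun x => ∫ t in F.x₀..x, F.vth t / t) (F.vth u / u) u := by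
    apply intervalIntegral.integral_hasDerivAt_right hint
    · exact (hcont.mono Set.Ioi_subset_Ici_self).stronglyMeasurableAtFilter isOpen_Ioi u hu
    · exact hcont.continuousAt (Ici_mem_nhds hu)
  have hp : HasDerivAt (fun x : ℝ => x ^ c) (c * u ^ (c - 1)) u :=
    Real.hasDerivAt_rpow_const (Or.inl hu0.ne')
  have h := (hp.const_mul F.Ch).mul hI.exp
  have heq : F.toFun =ᶠ[nhds u] fun x => F.Ch * x ^ c * Real.exp (∫ t in F.x₀..x, F.vth t / t) := by
    filter_upwards [Ici_mem_nhds hu] with x hx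
    exact F.eqn x hx
  refine (HasDerivAt.congr_of_eventuallyEq h heq).congr_deriv ?_
  rw [F.eqn u hu.le, Real.rpow_sub_one hu0.ne']
  field_simp

lemma strictMono : StrictMonoOn F.toFun (Set.Ici F.x₀) := by
  apply strictMonoOn_of_deriv_pos (convex_Ici _) F.contDiffOn.continuousOn
  intro x hx
  rw [interior_Ici] at hx
  exact F.deriv_pos x (le_of_lt hx)

section inv
variable {F} {φ : ℝ → ℝ}

lemma phi_strictMono (hφ₂ : ∀ y ≥ F.toFun F.x₀, F.toFun (φ y) = y)
    (hφ₃ : ∀ y ≥ F.toFun F.x₀, F.x₀ ≤ φ y) : StrictMonoOn φ (Set.Ici (F.toFun F.x₀)) := by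
  intro x hx y hy hxy
  by_contra h
  have := F.strictMono.monotoneOn (hφ₃ y hy) (hφ₃ x hx) (not_lt.1 h)
  rw [hφ₂ y hy, hφ₂ x hx] at this
  linarith

lemma phi_gt (hφ₂ : ∀ y ≥ F.toFun F.x₀, F.toFun (φ y) = y)
    (hφ₃ : ∀ y ≥ F.toFun F.x₀, F.x₀ ≤ φ y) {y : ℝ} (hy : F.toFun F.x₀ < y) : F.x₀ < φ y := by
  rcases (hφ₃ y hy.le).lt_or_eq with h | h
  · exact h
  · have := hφ₂ y hy.le
    rw [← h] at this
    linarith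

lemma phi_hasDeriv (hφ₁ : ∀ x ≥ F.x₀, φ (F.toFun x) = x)
    (hφ₂ : ∀ y ≥ F.toFun F.x₀, F.toFun (φ y) = y)
    (hφ₃ : ∀ y ≥ F.toFun F.x₀, F.x₀ ≤ φ y) {y : ℝ} (hy : F.toFun F.x₀ < y) (hq : c + F.vth (φ y) ≠ 0) :
    HasDerivAt φ (φ y / (y * (c + F.vth (φ y)))) y := by
  have hgt := phi_gt hφ₂ hφ₃ hy
  have hy0 : 0 < y := by linarith [F.one_le F.x₀ le_rfl]
  have hcont : ContinuousAt φ y := by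
    apply continuousAt_of_monotoneOn_of_image_mem_nhds (s := Set.Ici (F.toFun F.x₀))
      (phi_strictMono hφ₂ hφ₃).monotoneOn (Ici_mem_nhds hy)
    have : Set.Ici F.x₀ ⊆ φ '' Set.Ici (F.toFun F.x₀) := by
      intro u hu
      refine ⟨F.toFun u, F.strictMono.monotoneOn (Set.mem_Ici.2 le_rfl) hu hu, hφ₁ u hu⟩
    exact Filter.mem_of_superset (Ici_mem_nhds hgt) this
  have hd := F.hasDeriv hgt
  rw [hφ₂ y hy.le] at hd
  have hp0 : 0 < φ y := F.x₀_pos.trans hgt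
  have := HasDerivAt.of_local_left_inverse hcont hd (by positivity) (by
    filter_upwards [Ici_mem_nhds hy] with x hx
    exact hφ₂ x hx)
  rwa [inv_div] at this

end inv

noncomputable def sv (u : ℝ) : ℝ := if c = 1 then F.vth u else 1
noncomputable def qv (u : ℝ) : ℝ := c + F.vth u
noncomputable def Av (u : ℝ) : ℝ := u / F.qv u
noncomputable def A1 (u : ℝ) : ℝ := 1 / F.qv u - u * deriv F.vth u / F.qv u ^ 2
noncomputable def A2 (u : ℝ) : ℝ :=
  -2 * deriv F.vth u / F.qv u ^ 2 - u * deriv (deriv F.vth) u / F.qv u ^ 2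
    + 2 * u * deriv F.vth u ^ 2 / F.qv u ^ 3
noncomputable def Bv (u : ℝ) : ℝ := F.Av u * (F.A1 u - 1)
noncomputable def B1 (u : ℝ) : ℝ := F.A1 u * (F.A1 u - 1) + F.Av u * F.A2 u

lemma qv_hasDeriv {u : ℝ} (hu : F.x₀ < u) : HasDerivAt F.qv (deriv F.vth u) u :=
  (F.vth_hasDeriv hu).const_add c

lemma Av_hasDeriv {u : ℝ} (hu : F.x₀ < u) (hq : F.qv u ≠ 0) : HasDerivAt F.Av (F.A1 u) u := by
  refine ((hasDerivAt_id u).div (F.qv_hasDeriv hu) hq).congr_deriv ?_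
  unfold A1
  simp only [id]
  field_simp

lemma A1_hasDeriv {u : ℝ} (hu : F.x₀ < u) (hq : F.qv u ≠ 0) : HasDerivAt F.A1 (F.A2 u) u := by
  have h1 := (hasDerivAt_const u (1 : ℝ)).div (F.qv_hasDeriv hu) hq
  have h2 := ((hasDerivAt_id u).mul (F.vth_hasDeriv2 hu)).div ((F.qv_hasDeriv hu).pow 2) (pow_ne_zero 2 hq)
  refine (h1.sub h2).congr_deriv ?_
  unfold A2
  simp only [id, Pi.mul_apply, Pi.pow_apply]
  field_simp
  ring

lemma Bv_hasDeriv {u : ℝ} (hu : F.x₀ < u) (hq : F.qv u ≠ 0) : HasDerivAt F.Bv (F.B1 u) u := by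
  refine ((F.Av_hasDeriv hu hq).mul ((F.A1_hasDeriv hu hq).sub_const 1)).congr_deriv ?_
  unfold B1; ring

/-- asymptotics -/
lemma B1_tendsto (hc₁ : 1 ≤ c) (hs0 : ∀ᶠ u in atTop, 0 < F.sv u) :
    ∃ κ > 0, Tendsto (fun u => - F.B1 u / F.sv u) atTop (nhds κ) := by
  have hc0 : 0 < c := by linarith
  obtain ⟨κ₀, hκ₀, hv, hv1, hw1, hw2, hq1⟩ : ∃ κ₀ > 0, Tendsto F.vth atTop (nhds 0) ∧
      Tendsto (fun u => u * deriv F.vth u) atTop (nhds 0) ∧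
      Tendsto (fun u => u * deriv F.vth u / F.sv u) atTop (nhds 0) ∧
      Tendsto (fun u => u ^ 2 * deriv (deriv F.vth) u / F.sv u) atTop (nhds 0) ∧
      Tendsto (fun u => (1 / F.qv u - 1) / F.sv u) atTop (nhds (-κ₀)) := by
    rcases hc₁.eq_or_lt with h | h
    · obtain ⟨hp, -, -, -, hv, h1, h2⟩ := F.cond_eq h.symm
      have hsv : F.sv = F.vth := by ext u; simp [sv, h.symm]
      refine ⟨1, one_pos, hv, ?_, ?_, ?_, ?_⟩
      · have := h1.mul hv
        rw [zero_mul] at this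
        refine this.congr' ?_
        filter_upwards [hs0] with u hu
        rw [hsv] at hu
        field_simp
      · rw [hsv]; exact h1
      · rw [hsv]; exact h2
      · have hq : Tendsto F.qv atTop (nhds 1) := by
          have := hv.const_add c
          rw [add_zero] at this
          rw [congrArg nhds h]
          exact this
        have := (hq.inv₀ one_ne_zero).neg
        rw [inv_one] at this
        refine this.congr' ?_
        filter_upwards [hs0, hq.eventually_ne one_ne_zero] with u hu hu2
        have : F.sv u = F.qv u - 1 := by rw [hsv]; simp [qv, ← h]
        rw [this] at hu ⊢
        field_simp
        ring
    · obtain ⟨hv, h1, h2⟩ := F.cond_gt h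
      have hsv : ∀ u, F.sv u = 1 := by intro u; simp [sv, h.ne']
      refine ⟨1 - 1 / c, by rw [gt_iff_lt, sub_pos, div_lt_one hc0]; exact h, hv, h1, ?_, ?_, ?_⟩
      · simpa [hsv] using h1
      · simpa [hsv] using h2
      · have hq : Tendsto F.qv atTop (nhds c) := by
          have := hv.const_add c
          rw [add_zero] at this
          exact this
        have := (hq.inv₀ hc0.ne').sub_const 1
        simpa [hsv] using this
  have hq : Tendsto F.qv atTop (nhds c) := by
    have := hv.const_add c
    rw [add_zero] at this
    exact this
  have hqi := hq.inv₀ hc0.ne'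
  have hA1 : Tendsto F.A1 atTop (nhds (c⁻¹)) := by
    have := hqi.sub (hv1.mul (hqi.pow 2))
    rw [zero_mul, sub_zero] at this
    refine this.congr fun u => ?_
    unfold A1; simp [div_eq_mul_inv]
  refine ⟨c⁻¹ * κ₀, by positivity, ?_⟩
  have e1 : Tendsto (fun u => (F.A1 u - 1) / F.sv u) atTop (nhds (-κ₀)) := by
    have := hq1.sub (hw1.mul (hqi.pow 2))
    rw [zero_mul, sub_zero] at this
    refine this.congr fun u => ?_
    unfold A1; simp only [div_eq_mul_inv]; ring
  have e2 : Tendsto (fun u => F.Av u * F.A2 u / F.sv u) atTop (nhds 0) := by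
    have := hqi.mul ((((hw1.const_mul (-2)).mul (hqi.pow 2)).sub (hw2.mul (hqi.pow 2))).add
      (((hv1.mul hw1).const_mul 2).mul (hqi.pow 3)))
    simp only [mul_zero, zero_mul, sub_zero, add_zero] at this
    refine this.congr fun u => ?_
    unfold Av A2; simp only [div_eq_mul_inv]; ring
  have := ((hA1.mul e1).add e2).neg
  have h3 : -(c⁻¹ * -κ₀ + 0) = c⁻¹ * κ₀ := by ring
  rw [h3] at this
  refine this.congr fun u => ?_
  unfold B1; ring

lemma consts (hc₁ : 1 ≤ c) (hc₂ : c < 16 / 15) : ∃ u₁ κ₁ κ₂ S : ℝ, F.x₀ < u₁ ∧ 0 < κ₁ ∧ 0 < κ₂ ∧ 0 < S ∧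
    ∀ u ≥ u₁, 1 ≤ F.qv u ∧ F.qv u ≤ 2 ∧ 0 < F.sv u ∧ F.sv u ≤ S ∧
      κ₁ * F.sv u ≤ - F.B1 u ∧ - F.B1 u ≤ κ₂ * F.sv u ∧
      ∀ v, u ≤ v → v ≤ 8 * u → F.sv u / 8 ≤ F.sv v ∧ F.sv v ≤ F.sv u := by
  have hv : Tendsto F.vth atTop (nhds 0) := by
    rcases hc₁.eq_or_lt with h | h
    · exact (F.cond_eq h.symm).2.2.2.2.1
    · exact (F.cond_gt h).1
  have hs0 : ∀ᶠ u in atTop, 0 < F.sv u := by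
    rcases hc₁.eq_or_lt with h | h
    · filter_upwards [eventually_ge_atTop F.x₀] with u hu
      simp only [sv, h.symm, if_true]
      exact (F.cond_eq h.symm).1 u hu
    · exact Eventually.of_forall fun u => by simp [sv, h.ne']
  obtain ⟨κ, hκ, ht⟩ := F.B1_tendsto hc₁ hs0
  have ev1 : ∀ᶠ u in atTop, 1 ≤ F.qv u := by
    rcases hc₁.eq_or_lt with h | h
    · filter_upwards [hs0] with u hu
      simp only [sv, h.symm, if_true] at hu
      simp only [qv]; linarith
    · filter_upwards [hv.eventually (lt_mem_nhds (show 1 - c < 0 by linarith))] with u hu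
      simp only [qv]; linarith
  have ev2 : ∀ᶠ u in atTop, F.qv u ≤ 2 := by
    filter_upwards [hv.eventually (gt_mem_nhds (show (0:ℝ) < 1/2 by norm_num))] with u hu
    simp only [qv]; linarith
  have ev3 : ∀ᶠ u in atTop, κ / 2 * F.sv u ≤ - F.B1 u ∧ - F.B1 u ≤ 2 * κ * F.sv u := by
    filter_upwards [hs0, ht.eventually (lt_mem_nhds (show κ / 2 < κ by linarith)),
      ht.eventually (gt_mem_nhds (show κ < 2 * κ by linarith))] with u h0 h1 h2
    rw [lt_div_iff₀ h0] at h1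
    rw [div_lt_iff₀ h0] at h2
    exact ⟨h1.le, h2.le⟩
  obtain ⟨S, hS, ev4⟩ : ∃ S > 0, ∀ᶠ u in atTop, F.sv u ≤ S := by
    refine ⟨1, one_pos, ?_⟩
    rcases hc₁.eq_or_lt with h | h
    · filter_upwards [hv.eventually (gt_mem_nhds (show (0:ℝ) < 1 by norm_num))] with u hu
      simp only [sv, h.symm, if_true]; exact hu.le
    · exact Eventually.of_forall fun u => by simp [sv, h.ne']
  have ev5 : ∀ᶠ u in atTop, ∀ v, u ≤ v → v ≤ 8 * u → F.sv u / 8 ≤ F.sv v ∧ F.sv v ≤ F.sv u := by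
    rcases hc₁.eq_or_lt with h | h
    · obtain ⟨hp, hanti, -, -, -, h1, -⟩ := F.cond_eq h.symm
      have hsv : F.sv = F.vth := by ext u; simp [sv, h.symm]
      rw [hsv]
      obtain ⟨w, hw⟩ := eventually_atTop.1 (h1.eventually (lt_mem_nhds (show (-1:ℝ) < 0 by norm_num)))
      have hmono : MonotoneOn (fun u => u * F.vth u) (Set.Ici (max w (F.x₀ + 1))) := by
        have hgt : ∀ x ∈ Set.Ici (max w (F.x₀ + 1)), F.x₀ < x := by
          intro x hx
          have := le_max_right w (F.x₀ + 1)
          have := Set.mem_Ici.1 hx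
          linarith
        have hd : ∀ x ∈ Set.Ici (max w (F.x₀ + 1)), HasDerivAt (fun u => u * F.vth u) (1 * F.vth x + x * deriv F.vth x) x :=
          fun x hx => (hasDerivAt_id x).mul (F.vth_hasDeriv (hgt x hx))
        apply monotoneOn_of_deriv_nonneg (convex_Ici _)
        · exact fun x hx => (hd x hx).continuousAt.continuousWithinAt
        · intro x hx
          exact (hd x (interior_subset hx)).differentiableAt.differentiableWithinAt
        · intro x hx
          have hx := interior_subset hx
          rw [(hd x hx).deriv]
          have h3 := hw x ((le_max_left _ _).trans hx)
          have h4 := hp x (hgt x hx).le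
          rw [lt_div_iff₀ h4] at h3
          linarith
      filter_upwards [eventually_ge_atTop (max w (F.x₀ + 1))] with u hu v huv hv8
      have hu1 : F.x₀ + 1 ≤ u := (le_max_right _ _).trans hu
      have hx0 := F.x₀_pos
      refine ⟨?_, hanti u v (by linarith) huv⟩
      have h5 := hmono (Set.mem_Ici.2 hu) (Set.mem_Ici.2 (hu.trans huv)) huv
      simp only at h5
      have h6 := hp v (by linarith)
      have h7 : v * F.vth v ≤ 8 * u * F.vth v := by gcongr
      have h8 : u * F.vth u ≤ u * (8 * F.vth v) := by linarith
      have h9 := le_of_mul_le_mul_left h8 (by linarith)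
      linarith
    · refine Eventually.of_forall fun u v _ _ => ?_
      simp [sv, h.ne']; norm_num
  obtain ⟨w, hw⟩ := eventually_atTop.1 (ev1.and (ev2.and (hs0.and (ev4.and (ev3.and ev5)))))
  refine ⟨max w (F.x₀ + 1), κ / 2, 2 * κ, S, lt_of_lt_of_le (by linarith) (le_max_right _ _), by positivity, by positivity, hS, ?_⟩
  intro u hu
  obtain ⟨a1, a2, a3, a4, a5, a6⟩ := hw u ((le_max_left _ _).trans hu)
  exact ⟨a1, a2, a3, a4, a5.1, a5.2, a6⟩

lemma div_mono {u₁ : ℝ} (hu₁ : F.x₀ < u₁) (hq : ∀ u ≥ u₁, 1 ≤ F.qv u) :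
    MonotoneOn (fun u => F.toFun u / u) (Set.Ici u₁) := by
  have hx0 := F.x₀_pos
  have hd : ∀ x ∈ Set.Ici u₁, HasDerivAt (fun u => F.toFun u / u)
      ((F.toFun x * (c + F.vth x) / x * x - F.toFun x * 1) / x ^ 2) x := by
    intro x hx
    have hx' := Set.mem_Ici.1 hx
    exact (F.hasDeriv (by linarith)).div (hasDerivAt_id x) (by linarith)
  apply monotoneOn_of_deriv_nonneg (convex_Ici _)
  · exact fun x hx => (hd x hx).continuousAt.continuousWithinAt
  · intro x hx
    exact (hd x (interior_subset hx)).differentiableAt.differentiableWithinAt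
  · intro x hx
    have hx := interior_subset hx
    have hx' := Set.mem_Ici.1 hx
    rw [(hd x hx).deriv]
    have h1 := F.one_le x (by linarith)
    have h2 := hq x hx
    simp only [qv] at h2
    have hx1 : 0 < x := by linarith
    rw [div_mul_cancel₀ _ hx1.ne']
    apply div_nonneg _ (by positivity)
    nlinarith

end Fc

lemma second_diff_mvt (G G1 G2 : ℝ → ℝ) (t : ℝ)
    (h1 : ∀ x ∈ Set.Icc t (t + 2), HasDerivAt G (G1 x) x)
    (h2 : ∀ x ∈ Set.Icc t (t + 2), HasDerivAt G1 (G2 x) x) :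
    ∃ ξ ∈ Set.Icc t (t + 2), G (t + 2) - 2 * G (t + 1) + G t = G2 ξ := by
  have hd : ∀ x ∈ Set.Icc t (t + 1), HasDerivAt (fun x => G (x + 1) - G x) (G1 (x + 1) - G1 x) x := by
    intro x hx
    have := (h1 (x + 1) ⟨by linarith [hx.1], by linarith [hx.2]⟩).comp_add_const x 1
    exact this.sub (h1 x ⟨hx.1, by linarith [hx.2]⟩)
  obtain ⟨y, hy, hy2⟩ := exists_hasDerivAt_eq_slope (fun x => G (x + 1) - G x)
    (fun x => G1 (x + 1) - G1 x) (show t < t + 1 by linarith)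
    (fun x hx => (hd x hx).continuousAt.continuousWithinAt)
    (fun x hx => hd x (Set.Ioo_subset_Icc_self hx))
  have hsub : ∀ x ∈ Set.Icc y (y + 1), x ∈ Set.Icc t (t + 2) :=
    fun x hx => ⟨by linarith [hx.1, hy.1], by linarith [hx.2, hy.2]⟩
  obtain ⟨z, hz, hz2⟩ := exists_hasDerivAt_eq_slope G1 G2 (show y < y + 1 by linarith)
    (fun x hx => (h2 x (hsub x hx)).continuousAt.continuousWithinAt)
    (fun x hx => h2 x (hsub x (Set.Ioo_subset_Icc_self hx)))
  refine ⟨z, hsub z (Set.Ioo_subset_Icc_self hz), ?_⟩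
  rw [hz2, add_sub_cancel_left, div_one, hy2, add_sub_cancel_left, div_one,
    show t + 1 + 1 = t + 2 by ring]
  ring

set_option maxHeartbeats 1000000 in
lemma analytic {c : ℝ} (hc₁ : 1 ≤ c) (hc₂ : c < 16 / 15) (F : Fc c)
    (φ : ℝ → ℝ) (hφ₁ : ∀ x ≥ F.x₀, φ (F.toFun x) = x)
    (hφ₂ : ∀ y ≥ F.toFun F.x₀, F.toFun (φ y) = y)
    (hφ₃ : ∀ y ≥ F.toFun F.x₀, F.x₀ ≤ φ y) :
    ∃ X c₁ c₂ S C₃ : ℝ, 0 < X ∧ 0 < c₁ ∧ 0 < c₂ ∧ 0 < S ∧ 0 < C₃ ∧ ∀ N ≥ X,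
      0 < φ N ∧ sigmah F φ N * φ N ≤ C₃ * N ∧ sigmah F φ N ≤ S ∧ 0 < sigmah F φ N ∧
      ∀ K a b t : ℝ, 0 < K → 0 < a → a < b → K ≤ t → t + 2 ≤ 4 * K → N ≤ K * a → 4 * K * b ≤ 8 * N →
        ∀ G : ℝ → ℝ, (∀ x, G x = φ (x * b) - φ (x * a)) →
        c₁ * ((b - a) * (sigmah F φ N * φ N) / (K * N)) ≤ -(G (t + 2) - 2 * G (t + 1) + G t) ∧
        -(G (t + 2) - 2 * G (t + 1) + G t) ≤ c₂ * ((b - a) * (sigmah F φ N * φ N) / (K * N)) := by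
  obtain ⟨u₁, κ₁, κ₂, S, hu₁, hκ₁, hκ₂, hS, H⟩ := F.consts hc₁ hc₂
  have hx0 := F.x₀_pos
  have hu0 : 0 < u₁ := hx0.trans hu₁
  have hh1 : F.toFun F.x₀ < F.toFun u₁ := F.strictMono (Set.mem_Ici.2 le_rfl) (Set.mem_Ici.2 hu₁.le) hu₁
  have hh0 := F.one_le F.x₀ le_rfl
  have hmono := (Fc.phi_strictMono hφ₂ hφ₃).monotoneOn
  have hdm := F.div_mono hu₁ (fun u hu => (H u hu).1)
  have hge : ∀ y ≥ F.toFun u₁, u₁ ≤ φ y := by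
    intro y hy
    have := hmono (Set.mem_Ici.2 hh1.le) (Set.mem_Ici.2 (hh1.le.trans hy)) hy
    rwa [hφ₁ u₁ hu₁.le] at this
  have hsig : ∀ y, sigmah F φ y = F.sv (φ y) := fun y => rfl
  have h8 : ∀ N ≥ F.toFun u₁, φ (8 * N) ≤ 8 * φ N := by
    intro N hN
    have hp := hge N hN
    have hN0 : 0 < N := by linarith
    have h1 := hdm (Set.mem_Ici.2 hp) (Set.mem_Ici.2 (show u₁ ≤ 8 * φ N by linarith)) (show φ N ≤ 8 * φ N by linarith)
    simp only at h1
    rw [hφ₂ N (by linarith), div_le_div_iff₀ (by linarith) (by linarith)] at h1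
    have h2 : 8 * N ≤ F.toFun (8 * φ N) := by
      have : 0 < φ N := by linarith
      nlinarith
    have h3 := hmono (Set.mem_Ici.2 (show F.toFun F.x₀ ≤ 8 * N by linarith))
      (Set.mem_Ici.2 (show F.toFun F.x₀ ≤ F.toFun (8 * φ N) by linarith)) h2
    rwa [hφ₁ _ (by linarith)] at h3
  refine ⟨F.toFun u₁, κ₁ / 512, 8 * κ₂, S, S * (u₁ / F.toFun u₁), by linarith, by positivity, by positivity, hS,
    by have : 0 < F.toFun u₁ := by linarith
       positivity, ?_⟩
  intro N hN
  have hpN := hge N hN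
  have hN0 : 0 < N := by linarith
  have hp0 : 0 < φ N := by linarith
  obtain ⟨-, -, hs0, hsS, -, -, hs8⟩ := H (φ N) hpN
  refine ⟨hp0, ?_, hsS, hs0, ?_⟩
  · have h1 := hdm (Set.mem_Ici.2 le_rfl) (Set.mem_Ici.2 hpN) hpN
    simp only at h1
    have hhu : 0 < F.toFun u₁ := by linarith
    rw [hφ₂ N (by linarith), div_le_div_iff₀ hu0 hp0] at h1
    have h2 : φ N ≤ u₁ / F.toFun u₁ * N := by
      rw [div_mul_eq_mul_div, le_div_iff₀ hhu]; linarith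
    rw [hsig, mul_assoc]
    exact mul_le_mul hsS h2 hp0.le hS.le
  intro K a b t hK ha hab hKt ht4 hNa hNb G hG
  have hb : 0 < b := ha.trans hab
  have hG' : G = fun x => φ (x * b) - φ (x * a) := funext hG
  -- range facts
  have range : ∀ y, N ≤ y → y ≤ 8 * N → φ N ≤ φ y ∧ φ y ≤ 8 * φ N ∧ u₁ ≤ φ y := by
    intro y h1 h2
    have r1 := hmono (Set.mem_Ici.2 (show F.toFun F.x₀ ≤ N by linarith)) (Set.mem_Ici.2 (show F.toFun F.x₀ ≤ y by linarith)) h1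
    have r2 := hmono (Set.mem_Ici.2 (show F.toFun F.x₀ ≤ y by linarith)) (Set.mem_Ici.2 (show F.toFun F.x₀ ≤ 8 * N by linarith)) h2
    exact ⟨r1, r2.trans (h8 N hN), hpN.trans r1⟩
  have hder : ∀ y, N ≤ y → y ≤ 8 * N → HasDerivAt φ (φ y / (y * F.qv (φ y))) y := by
    intro y h1 h2
    have := (H (φ y) (range y h1 h2).2.2).1
    exact Fc.phi_hasDeriv hφ₁ hφ₂ hφ₃ (by linarith) (by unfold Fc.qv at this; linarith)
  have hmem : ∀ x ∈ Set.Icc t (t + 2), ∀ d, a ≤ d → d ≤ b → N ≤ x * d ∧ x * d ≤ 8 * N ∧ 0 < x := by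
    intro x hx d h1 h2
    have x1 : K ≤ x := hKt.trans hx.1
    have x2 : x ≤ 4 * K := hx.2.trans ht4
    refine ⟨hNa.trans ?_, le_trans ?_ hNb, by linarith⟩
    · exact mul_le_mul x1 h1 ha.le (by linarith)
    · exact mul_le_mul x2 h2 (by linarith) (by linarith)
  have d1 : ∀ d, a ≤ d → d ≤ b → ∀ x ∈ Set.Icc t (t + 2),
      HasDerivAt (fun x => φ (x * d)) (F.Av (φ (x * d)) / x) x := by
    intro d h1 h2 x hx
    obtain ⟨m1, m2, m3⟩ := hmem x hx d h1 h2
    have hd0 : 0 < d := by linarith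
    have hq := (H (φ (x * d)) (range _ m1 m2).2.2).1
    have hq0 : 0 < F.qv (φ (x * d)) := by linarith
    have := (hder (x * d) m1 m2).comp x ((hasDerivAt_id x).mul_const d)
    refine this.congr_deriv ?_
    unfold Fc.Av
    field_simp
  have d2 : ∀ d, a ≤ d → d ≤ b → ∀ x ∈ Set.Icc t (t + 2),
      HasDerivAt (fun x => F.Av (φ (x * d)) / x) (F.Bv (φ (x * d)) / x ^ 2) x := by
    intro d h1 h2 x hx
    obtain ⟨m1, m2, m3⟩ := hmem x hx d h1 h2
    have hr := (range _ m1 m2).2.2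
    have hq := (H (φ (x * d)) hr).1
    have hq0 : F.qv (φ (x * d)) ≠ 0 := by linarith
    have h3 := (F.Av_hasDeriv (by linarith : F.x₀ < φ (x * d)) hq0).comp x (d1 d h1 h2 x hx)
    refine (h3.div (hasDerivAt_id x) m3.ne').congr_deriv ?_
    unfold Fc.Bv
    simp only [id, Function.comp]
    field_simp
  obtain ⟨x, hx, hx2⟩ := second_diff_mvt G (fun x => F.Av (φ (x * b)) / x - F.Av (φ (x * a)) / x)
    (fun x => F.Bv (φ (x * b)) / x ^ 2 - F.Bv (φ (x * a)) / x ^ 2) t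
    (fun x hx => by rw [hG']; exact (d1 b hab.le le_rfl x hx).sub (d1 a le_rfl hab.le x hx))
    (fun x hx => (d2 b hab.le le_rfl x hx).sub (d2 a le_rfl hab.le x hx))
  rw [hx2]
  obtain ⟨ma1, ma2, hx0'⟩ := hmem x hx a le_rfl hab.le
  obtain ⟨mb1, mb2, -⟩ := hmem x hx b hab.le le_rfl
  have hxab : x * a < x * b := by gcongr
  -- MVT for φ
  obtain ⟨η, hη, hη2⟩ := exists_hasDerivAt_eq_slope φ (fun y => φ y / (y * F.qv (φ y))) hxab
    (fun y hy => (hder y (ma1.trans hy.1) (hy.2.trans mb2)).continuousAt.continuousWithinAt)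
    (fun y hy => hder y (ma1.trans hy.1.le) (hy.2.le.trans mb2))
  have hη1 : N ≤ η := ma1.trans hη.1.le
  have hη8 : η ≤ 8 * N := hη.2.le.trans mb2
  have hη0 : 0 < η := by linarith
  obtain ⟨r1, r2, r3⟩ := range η hη1 hη8
  obtain ⟨q1, q2, -⟩ := H (φ η) r3
  rw [eq_div_iff (by linarith)] at hη2
  have hlt : φ (x * a) < φ (x * b) :=
    Fc.phi_strictMono hφ₂ hφ₃ (Set.mem_Ici.2 (by linarith)) (Set.mem_Ici.2 (by linarith)) hxab
  obtain ⟨ra1, ra2, ra3⟩ := range _ ma1 ma2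
  obtain ⟨rb1, rb2, rb3⟩ := range _ mb1 mb2
  have hB : ∀ u, u₁ ≤ u → HasDerivAt F.Bv (F.B1 u) u := by
    intro u hu
    have := (H u hu).1
    exact F.Bv_hasDeriv (by linarith) (by linarith)
  obtain ⟨ξ, hξ, hξ2⟩ := exists_hasDerivAt_eq_slope F.Bv F.B1 hlt
    (fun y hy => (hB y (ra3.trans hy.1)).continuousAt.continuousWithinAt)
    (fun y hy => hB y (ra3.trans hy.1.le))
  rw [eq_div_iff (by linarith)] at hξ2
  have hξ1 : u₁ ≤ ξ := ra3.trans hξ.1.le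
  obtain ⟨-, -, sξ, -, B1l, B1u, -⟩ := H ξ hξ1
  obtain ⟨s1, s2⟩ := hs8 ξ (ra1.trans hξ.1.le) (hξ.2.le.trans rb2)
  rw [hsig]
  set s := F.sv (φ N)
  set D := φ η / (η * F.qv (φ η)) with hD
  have hD1 : φ N / (16 * N) ≤ D := by
    apply div_le_div₀ (by linarith) r1 (by positivity)
    calc η * F.qv (φ η) ≤ (8 * N) * 2 := mul_le_mul hη8 q2 (by linarith) (by linarith)
      _ = 16 * N := by ring
  have hD2 : D ≤ 8 * φ N / N := by
    apply div_le_div₀ (by linarith) r2 hN0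
    calc N = N * 1 := by ring
      _ ≤ η * F.qv (φ η) := mul_le_mul hη1 q1 (by norm_num) (by linarith)
  have x1 : K ≤ x := hKt.trans hx.1
  have x2 : x ≤ 4 * K := hx.2.trans ht4
  have hval : -(F.Bv (φ (x * b)) / x ^ 2 - F.Bv (φ (x * a)) / x ^ 2) = (-F.B1 ξ) * D * (b - a) * (1 / x) := by
    have : F.Bv (φ (x * b)) - F.Bv (φ (x * a)) = F.B1 ξ * (D * (x * b - x * a)) := by
      rw [hη2, hξ2]
    rw [← sub_div, this]
    field_simp
  rw [hval]
  have hxi1 : 1 / (4 * K) ≤ 1 / x := one_div_le_one_div_of_le hx0' x2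
  have hxi2 : 1 / x ≤ 1 / K := one_div_le_one_div_of_le hK x1
  have hba : 0 < b - a := by linarith
  have hB1 : κ₁ * (s / 8) ≤ -F.B1 ξ := le_trans (by gcongr) B1l
  have hB2 : -F.B1 ξ ≤ κ₂ * s := B1u.trans (by gcongr)
  have hD0 : 0 < φ N / (16 * N) := by positivity
  constructor
  · calc _ = κ₁ * (s / 8) * (φ N / (16 * N)) * (b - a) * (1 / (4 * K)) := by field_simp; norm_num
      _ ≤ _ := by
        have : 0 ≤ -F.B1 ξ := le_trans (by positivity) hB1
        have : 0 ≤ D := by linarith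
        gcongr
  · calc _ ≤ κ₂ * s * (8 * φ N / N) * (b - a) * (1 / K) := by
          have : 0 ≤ -F.B1 ξ := le_trans (by positivity) hB1
          have : 0 ≤ D := by linarith
          gcongr
      _ = _ := by field_simp

lemma exists_H (Z : ℝ) (hZ : 1 ≤ Z) : ∃ H : ℕ, 1 ≤ H ∧ (H : ℝ) ^ 3 ≤ Z ∧ Z ≤ 8 * (H : ℝ) ^ 3 := by
  have hY : (1 : ℝ) ≤ Z ^ ((1 : ℝ) / 3) := Real.one_le_rpow hZ (by norm_num)
  have hY3 : (Z ^ ((1 : ℝ) / 3)) ^ 3 = Z := by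
    rw [← Real.rpow_natCast, ← Real.rpow_mul (by linarith)]; norm_num
  set Y := Z ^ ((1 : ℝ) / 3)
  refine ⟨⌊Y⌋₊, Nat.le_floor (by exact_mod_cast hY), ?_, ?_⟩
  · rw [← hY3]
    exact pow_le_pow_left₀ (Nat.cast_nonneg _) (Nat.floor_le (by linarith)) 3
  · have h1 : (1 : ℝ) ≤ ⌊Y⌋₊ := by exact_mod_cast Nat.le_floor (by exact_mod_cast hY)
    have h2 : Y ≤ 2 * (⌊Y⌋₊ : ℝ) := by linarith [Nat.lt_floor_add_one Y]
    calc Z = Y ^ 3 := hY3.symm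
      _ ≤ (2 * (⌊Y⌋₊ : ℝ)) ^ 3 := pow_le_pow_left₀ (by linarith) h2 3
      _ = _ := by ring

lemma pair_bound {c : ℝ} (F : Fc c) (φ : ℝ → ℝ) (c₁ c₂ N W : ℝ) (hc1 : 0 < c₁) (hc2 : 0 < c₂)
    (hW : 0 < W) (K L : ℕ) (hK : 1 ≤ K) (hL : 1 ≤ L) (hN : N = (K : ℝ) * L)
    (han : ∀ K a b t : ℝ, 0 < K → 0 < a → a < b → K ≤ t → t + 2 ≤ 4 * K → N ≤ K * a → 4 * K * b ≤ 8 * N →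
        ∀ G : ℝ → ℝ, (∀ x, G x = φ (x * b) - φ (x * a)) →
        c₁ * ((b - a) * W / (K * N)) ≤ -(G (t + 2) - 2 * G (t + 1) + G t) ∧
        -(G (t + 2) - 2 * G (t + 1) + G t) ≤ c₂ * ((b - a) * W / (K * N)))
    (m : ℤ) (hm : m ≠ 0) (α : ℝ) (H : ℕ) (p : ℕ → ℕ → Prop)
    (hp : ∀ l k₁ k₂ k, p l k₁ → p l k₂ → k₁ ≤ k → k ≤ k₂ → p l k)
    (w : ℕ → ℕ → ℂ)
    (hw : ∀ l k, w l k = if p l k then e (α * k * l + (m : ℝ) * φ ((k : ℝ) * l)) else 0)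
    (l l' : ℕ) (hl : l ∈ Finset.Ioc L (2 * L)) (hl' : l' ∈ Finset.Ioc L (2 * L)) (hll : l < l')
    (hH : l' - l < H) :
    ‖∑ k ∈ Finset.Ioc K (2 * K), w l k * (starRingEnd ℂ) (w l' k)‖ ≤
      16 * (1 + c₂ / c₁) * ((K : ℝ) * √(c₁ * (|(m : ℝ)| * H * W / (K * N)))
        + 1 / √(c₁ * (|(m : ℝ)| * W / (K * N)))) := by
  have hK0 : (0 : ℝ) < K := by exact_mod_cast hK
  have hL0 : (0 : ℝ) < L := by exact_mod_cast hL
  have hN0 : 0 < N := by rw [hN]; positivity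
  have hmR : (m : ℝ) ≠ 0 := by exact_mod_cast hm
  have hm0 : 0 < |(m : ℝ)| := abs_pos.2 hmR
  rw [Finset.mem_Ioc] at hl hl'
  set f : ℕ → ℝ := fun k => α * k * l - α * k * l' - (m : ℝ) * (φ ((k : ℝ) * l') - φ ((k : ℝ) * l)) with hf
  set J := (Finset.Ioc K (2 * K)).filter (fun k => p l k ∧ p l' k) with hJ
  have hsum : ∑ k ∈ Finset.Ioc K (2 * K), w l k * (starRingEnd ℂ) (w l' k) = ∑ k ∈ J, e (f k) := by
    rw [hJ, Finset.sum_filter]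
    refine Finset.sum_congr rfl fun k _ => ?_
    rw [hw, hw]
    by_cases h1 : p l k
    · by_cases h2 : p l' k
      · simp only [h1, h2, and_self, if_true]
        rw [← e_neg, ← e_add]
        congr 1
        simp only [hf]; ring
      · simp [h1, h2]
    · simp [h1]
  rw [hsum]
  set r : ℝ := (l' : ℝ) - l with hr
  have hr1 : 1 ≤ r := by
    have : (l : ℝ) + 1 ≤ l' := by exact_mod_cast hll
    linarith
  have hrH : r ≤ H := by
    have : l' ≤ H + l := by omega
    have : (l' : ℝ) ≤ H + l := by exact_mod_cast this
    linarith
  set lam := c₁ * (|(m : ℝ)| * r * W / (K * N)) with hlam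
  have hlam0 : 0 < lam := by positivity
  have hA : 1 ≤ 1 + c₂ / c₁ := by have : 0 < c₂ / c₁ := by positivity
                                  linarith
  obtain ⟨ε, hε, hεm⟩ : ∃ ε : ℝ, (ε = 1 ∨ ε = -1) ∧ ε * m = |(m : ℝ)| := by
    rcases lt_or_gt_of_ne hmR with h | h
    · exact ⟨-1, Or.inr rfl, by rw [abs_of_neg h]; ring⟩
    · exact ⟨1, Or.inl rfl, by rw [abs_of_pos h]; ring⟩
  have hv := vdc f J K lam (1 + c₂ / c₁) ε hlam0 hA hε
    (by
      intro x hx y hy z hxz hzy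
      rw [hJ, Finset.mem_filter, Finset.mem_Ioc] at hx hy ⊢
      refine ⟨by omega, ?_, ?_⟩
      · exact hp l x y z hx.2.1 hy.2.1 hxz hzy
      · exact hp l' x y z hx.2.2 hy.2.2 hxz hzy)
    (by
      refine (Finset.card_filter_le _ _).trans ?_
      rw [Nat.card_Ioc]; omega)
    (by
      intro n hn
      rw [hJ, Finset.mem_filter, Finset.mem_Ioc] at hn
      obtain ⟨⟨n1, n2⟩, -⟩ := hn
      have n1' : (K : ℝ) ≤ n := by exact_mod_cast n1.le
      have n2' : (n : ℝ) + 2 ≤ 4 * K := by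
        have : n + 2 ≤ 4 * K := by omega
        exact_mod_cast this
      have l1 : (L : ℝ) ≤ l := by exact_mod_cast hl.1.le
      have l2 : (l' : ℝ) ≤ 2 * L := by exact_mod_cast hl'.2
      have hG := han K l l' n hK0 (by linarith) (by exact_mod_cast hll) n1' n2'
        (by rw [hN]; gcongr)
        (by rw [hN]; nlinarith)
        (fun x => φ (x * l') - φ (x * l)) (fun x => rfl)
      set X := -((φ (((n : ℝ) + 2) * l') - φ (((n : ℝ) + 2) * l)) - 2 * (φ (((n : ℝ) + 1) * l') - φ (((n : ℝ) + 1) * l))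
        + (φ ((n : ℝ) * l') - φ ((n : ℝ) * l))) with hX
      have hfe : ε * (f (n + 2) - 2 * f (n + 1) + f n) = |(m : ℝ)| * X := by
        rw [← hεm, hX]
        simp only [hf]
        push_cast
        ring
      rw [hfe]
      constructor
      · calc lam = |(m : ℝ)| * (c₁ * (((l' : ℝ) - l) * W / (K * N))) := by rw [hlam, hr]; ring
          _ ≤ _ := mul_le_mul_of_nonneg_left hG.1 hm0.le
      · calc |(m : ℝ)| * X ≤ |(m : ℝ)| * (c₂ * (((l' : ℝ) - l) * W / (K * N))) :=
              mul_le_mul_of_nonneg_left hG.2 hm0.le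
          _ = c₂ / c₁ * lam := by rw [hlam, hr]; field_simp
          _ ≤ _ := by nlinarith)
  refine hv.trans ?_
  have e1 : √lam ≤ √(c₁ * (|(m : ℝ)| * H * W / (K * N))) := by
    apply Real.sqrt_le_sqrt
    rw [hlam]; gcongr
  have e2 : √(c₁ * (|(m : ℝ)| * W / (K * N))) ≤ √lam := by
    apply Real.sqrt_le_sqrt
    rw [hlam]
    have : |(m : ℝ)| ≤ |(m : ℝ)| * r := by nlinarith
    gcongr
  have e3 : 0 < √(c₁ * (|(m : ℝ)| * W / (K * N))) := Real.sqrt_pos.2 (by positivity)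
  have e4 : 1 / √lam ≤ 1 / √(c₁ * (|(m : ℝ)| * W / (K * N))) := one_div_le_one_div_of_le e3 e2
  gcongr

set_option maxHeartbeats 1000000 in
lemma core {c : ℝ} (hc₁ : 1 ≤ c) (hc₂ : c < 16 / 15) (F : Fc c)
    (φ : ℝ → ℝ) (hφ₁ : ∀ x ≥ F.x₀, φ (F.toFun x) = x)
    (hφ₂ : ∀ y ≥ F.toFun F.x₀, F.toFun (φ y) = y)
    (hφ₃ : ∀ y ≥ F.toFun F.x₀, F.x₀ ≤ φ y) :
    ∃ C > 0, ∃ X > 0, ∀ K L : ℕ, 1 ≤ K → 1 ≤ L → X ≤ (K : ℝ) * L → ∀ m : ℤ, m ≠ 0 →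
      |(m : ℝ)| * L ≤ sigmah F φ ((K : ℝ) * L) * φ ((K : ℝ) * L) →
      φ ((K : ℝ) * L) ≤ (L : ℝ) ^ 4 →
      ∀ (a b : ℕ → ℂ) (α : ℝ) (p : ℕ → ℕ → Prop),
      (∀ l k₁ k₂ k, p l k₁ → p l k₂ → k₁ ≤ k → k ≤ k₂ → p l k) →
      ‖∑ l ∈ Finset.Ioc L (2 * L), ∑ k ∈ Finset.Ioc K (2 * K),
        if p l k then a l * b k * e (α * k * l + (m : ℝ) * φ ((k : ℝ) * l)) else 0‖ ^ 2 ≤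
      C * (|(m : ℝ)| * L / (sigmah F φ ((K : ℝ) * L) * φ ((K : ℝ) * L))) ^ ((1 : ℝ) / 3) * (K * L) *
        ((∑ l ∈ Finset.Ioc L (2 * L), ‖a l‖ ^ 2) * (∑ k ∈ Finset.Ioc K (2 * K), ‖b k‖ ^ 2)) := by
  obtain ⟨X, c₁, c₂, S, C₃, hX, hc1, hc2, hS, hC3, H⟩ := analytic hc₁ hc₂ F φ hφ₁ hφ₂ hφ₃
  set S' := max 1 S with hS'
  have hS'1 : 1 ≤ S' := le_max_left _ _
  have hSS' : S ≤ S' := le_max_right _ _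
  set C4 := 16 * (1 + c₂ / c₁) * (√c₁ * C₃ + 1 / √c₁) with hC4
  have hsc : 0 < √c₁ := Real.sqrt_pos.2 hc1
  have hC40 : 0 < C4 := by positivity
  refine ⟨2 * (1 + 2 * S') * (1 + C4), by positivity, X, hX, ?_⟩
  intro K L hK hL hKL m hm hmL hphi a b α p hp
  obtain ⟨hp0, hWN, hsS, hs0, han⟩ := H _ hKL
  have hK0 : (0 : ℝ) < K := by exact_mod_cast hK
  have hL0 : (0 : ℝ) < L := by exact_mod_cast hL
  have hmR : (m : ℝ) ≠ 0 := by exact_mod_cast hm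
  have hm1 : 1 ≤ |(m : ℝ)| := by
    have := Int.one_le_abs hm
    exact_mod_cast this
  have hm0 : 0 < |(m : ℝ)| := by linarith
  have hWS : sigmah F φ ((K : ℝ) * L) * φ ((K : ℝ) * L) ≤ S' * (L : ℝ) ^ 4 :=
    mul_le_mul (hsS.trans hSS') hphi hp0.le (by linarith)
  have hW0 : 0 < sigmah F φ ((K : ℝ) * L) * φ ((K : ℝ) * L) := by positivity
  set W := sigmah F φ ((K : ℝ) * L) * φ ((K : ℝ) * L) with hW
  have hmL0 : 0 < |(m : ℝ)| * L := by positivity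
  obtain ⟨Hn, hH1, hH2, hH3⟩ := exists_H (W / (|(m : ℝ)| * L)) (by rw [le_div_iff₀ hmL0]; linarith)
  rw [le_div_iff₀ hmL0] at hH2
  rw [div_le_iff₀ hmL0] at hH3
  have hH0 : (0 : ℝ) < Hn := by exact_mod_cast hH1
  have hH1' : (1 : ℝ) ≤ Hn := by exact_mod_cast hH1
  set w : ℕ → ℕ → ℂ := fun l k => if p l k then e (α * k * l + (m : ℝ) * φ ((k : ℝ) * l)) else 0 with hw
  have hsum : ∑ l ∈ Finset.Ioc L (2 * L), ∑ k ∈ Finset.Ioc K (2 * K),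
        (if p l k then a l * b k * e (α * k * l + (m : ℝ) * φ ((k : ℝ) * l)) else 0) =
      ∑ l ∈ Finset.Ioc L (2 * L), ∑ k ∈ Finset.Ioc K (2 * K), a l * b k * w l k := by
    refine Finset.sum_congr rfl fun l _ => Finset.sum_congr rfl fun k _ => ?_
    simp only [hw]; split_ifs <;> simp
  rw [hsum]
  set U := 16 * (1 + c₂ / c₁) * ((K : ℝ) * √(c₁ * (|(m : ℝ)| * Hn * W / (K * ((K : ℝ) * L))))
        + 1 / √(c₁ * (|(m : ℝ)| * W / (K * ((K : ℝ) * L))))) with hU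
  have hU0 : 0 ≤ U := by positivity
  have hblock := bilinear_block K L Hn hH1 a b w U hU0
    (by intro l k; simp only [hw]; split_ifs
        · rw [norm_e]
        · simp)
    (by intro l hl l' hl' hll hH
        exact pair_bound F φ c₁ c₂ _ W hc1 hc2 hW0 K L hK hL rfl han m hm α Hn p hp w (fun l k => rfl)
          l l' hl hl' hll hH)
  refine hblock.trans ?_
  -- H U ≤ C4 K
  have hU1 : Hn * √(c₁ * (|(m : ℝ)| * Hn * W / (K * ((K : ℝ) * L)))) ≤ √c₁ * C₃ := by
    apply le_of_sq_le_sq _ (by positivity)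
    rw [mul_pow, mul_pow, Real.sq_sqrt (by positivity), Real.sq_sqrt hc1.le]
    have h1 : (Hn : ℝ) ^ 2 * (c₁ * (|(m : ℝ)| * Hn * W / (K * ((K : ℝ) * L)))) =
        c₁ * ((Hn : ℝ) ^ 3 * (|(m : ℝ)| * L) * W / ((K : ℝ) * L) ^ 2) := by
      field_simp
    rw [h1]
    apply mul_le_mul_of_nonneg_left _ hc1.le
    rw [div_le_iff₀ (by positivity)]
    calc (Hn : ℝ) ^ 3 * (|(m : ℝ)| * L) * W ≤ W * W := by gcongr
      _ ≤ (C₃ * ((K : ℝ) * L)) * (C₃ * ((K : ℝ) * L)) := by gcongr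
      _ = _ := by ring
  have hU2 : Hn * (1 / √(c₁ * (|(m : ℝ)| * W / (K * ((K : ℝ) * L))))) ≤ K * (1 / √c₁) := by
    have h0 : 0 < √(c₁ * (|(m : ℝ)| * W / (K * ((K : ℝ) * L)))) := Real.sqrt_pos.2 (by positivity)
    rw [mul_one_div, mul_one_div, div_le_div_iff₀ h0 hsc]
    apply le_of_sq_le_sq _ (by positivity)
    rw [mul_pow, mul_pow, Real.sq_sqrt hc1.le, Real.sq_sqrt (by positivity)]
    have h1 : (K : ℝ) ^ 2 * (c₁ * (|(m : ℝ)| * W / (K * ((K : ℝ) * L)))) = c₁ * (|(m : ℝ)| * W / L) := by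
      field_simp
    rw [h1, mul_comm]
    apply mul_le_mul_of_nonneg_left _ hc1.le
    rw [le_div_iff₀ hL0]
    have h2 : (Hn : ℝ) ^ 2 ≤ (Hn : ℝ) ^ 3 := pow_le_pow_right₀ hH1' (by norm_num)
    calc (Hn : ℝ) ^ 2 * L ≤ (Hn : ℝ) ^ 3 * (|(m : ℝ)| * L) := by
          apply mul_le_mul h2 _ hL0.le (by positivity)
          nlinarith
      _ ≤ W := hH2
      _ ≤ |(m : ℝ)| * W := by nlinarith
  have hHU : Hn * U ≤ C4 * K := by
    calc Hn * U = 16 * (1 + c₂ / c₁) * (K * (Hn * √(c₁ * (|(m : ℝ)| * Hn * W / (K * ((K : ℝ) * L))))) +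
          Hn * (1 / √(c₁ * (|(m : ℝ)| * W / (K * ((K : ℝ) * L)))))) := by rw [hU]; ring
      _ ≤ 16 * (1 + c₂ / c₁) * (K * (√c₁ * C₃) + K * (1 / √c₁)) := by gcongr
      _ = _ := by rw [hC4]; ring
  have hHL : (Hn : ℝ) ≤ S' * L := by
    apply le_of_pow_le_pow_left₀ (n := 3) (by norm_num) (by positivity)
    have h1 : (Hn : ℝ) ^ 3 * L ≤ (S' * L) ^ 3 * L := by
      calc (Hn : ℝ) ^ 3 * L ≤ (Hn : ℝ) ^ 3 * (|(m : ℝ)| * L) := by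
            apply mul_le_mul_of_nonneg_left _ (by positivity)
            nlinarith
        _ ≤ W := hH2
        _ ≤ S' * L ^ 4 := hWS
        _ ≤ S' ^ 3 * L ^ 4 := by
            apply mul_le_mul_of_nonneg_right _ (by positivity)
            exact le_self_pow₀ hS'1 (by norm_num)
        _ = _ := by ring
    exact le_of_mul_le_mul_right h1 hL0
  have hLH : (L : ℝ) / Hn + 2 ≤ (1 + 2 * S') * (L * (1 / Hn)) := by
    have : 2 ≤ 2 * (S' * L / Hn) := by
      have : 1 ≤ S' * L / Hn := by rw [le_div_iff₀ hH0]; linarith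
      linarith
    calc _ ≤ (L : ℝ) / Hn + 2 * (S' * L / Hn) := by linarith
      _ = _ := by ring
  have hR : 1 / (Hn : ℝ) ≤ 2 * (|(m : ℝ)| * L / W) ^ ((1 : ℝ) / 3) := by
    have h1 : (1 / (2 * (Hn : ℝ))) ^ 3 ≤ |(m : ℝ)| * L / W := by
      rw [div_pow, one_pow, div_le_div_iff₀ (by positivity) hW0]
      linarith
    have h2 := Real.rpow_le_rpow (by positivity) h1 (show (0:ℝ) ≤ 1 / 3 by norm_num)
    rw [← Real.rpow_natCast, ← Real.rpow_mul (by positivity)] at h2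
    norm_num at h2
    have h3 : 1 / (Hn : ℝ) = 2 * ((Hn : ℝ)⁻¹ * 2⁻¹) := by field_simp
    rw [h3]
    norm_num
    linarith
  set R := (|(m : ℝ)| * L / W) ^ ((1 : ℝ) / 3)
  have hR0 : 0 ≤ R := by positivity
  set E1 := ∑ l ∈ Finset.Ioc L (2 * L), ‖a l‖ ^ 2
  set E2 := ∑ k ∈ Finset.Ioc K (2 * K), ‖b k‖ ^ 2
  have hE1 : 0 ≤ E1 := by positivity
  have hE2 : 0 ≤ E2 := by positivity
  calc E2 * (((L : ℝ) / Hn + 2) * (E1 * (K + Hn * U)))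
      ≤ E2 * (((1 + 2 * S') * (L * (2 * R))) * (E1 * (K + C4 * K))) := by
        apply mul_le_mul_of_nonneg_left _ hE2
        apply mul_le_mul
        · refine hLH.trans ?_
          gcongr
        · gcongr
        · positivity
        · positivity
    _ = _ := by ring

lemma log_ineq (L : ℕ) (hL : 1 ≤ L) : Real.log L ^ 3 ≤ Real.log L ^ 4 / Real.log 2 := by
  have h2 : 0 < Real.log 2 := Real.log_pos (by norm_num)
  rcases hL.eq_or_lt with h | h
  · rw [← h]; simp
  · have : Real.log 2 ≤ Real.log L := Real.log_le_log (by norm_num) (by exact_mod_cast h)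
    rw [le_div_iff₀ h2, pow_succ (Real.log L) 3]
    gcongr

/-- the trivial bound -/
lemma triv_bound (K L : ℕ) (a b : ℕ → ℂ) (w : ℕ → ℕ → ℂ) (hw : ∀ l k, ‖w l k‖ ≤ 1) :
    ‖∑ l ∈ Finset.Ioc L (2 * L), ∑ k ∈ Finset.Ioc K (2 * K), a l * b k * w l k‖ ^ 2 ≤
      ((K : ℝ) * L) * ((∑ l ∈ Finset.Ioc L (2 * L), ‖a l‖ ^ 2) * (∑ k ∈ Finset.Ioc K (2 * K), ‖b k‖ ^ 2)) := by
  have h1 : ‖∑ l ∈ Finset.Ioc L (2 * L), ∑ k ∈ Finset.Ioc K (2 * K), a l * b k * w l k‖ ≤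
      (∑ l ∈ Finset.Ioc L (2 * L), ‖a l‖) * (∑ k ∈ Finset.Ioc K (2 * K), ‖b k‖) := by
    rw [Finset.sum_mul_sum]
    refine (norm_sum_le _ _).trans (Finset.sum_le_sum fun l _ => ?_)
    refine (norm_sum_le _ _).trans (Finset.sum_le_sum fun k _ => ?_)
    rw [norm_mul, norm_mul]
    exact mul_le_of_le_one_right (by positivity) (hw l k)
  have hc : ∀ M : ℕ, ∀ x : ℕ → ℂ, (∑ l ∈ Finset.Ioc M (2 * M), ‖x l‖) ^ 2 ≤ M * ∑ l ∈ Finset.Ioc M (2 * M), ‖x l‖ ^ 2 := by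
    intro M x
    have := sq_sum_le_card_mul_sum_sq (s := Finset.Ioc M (2 * M)) (f := fun l => ‖x l‖)
    rw [Nat.card_Ioc, show 2 * M - M = M by omega] at this
    exact this
  calc _ ≤ ((∑ l ∈ Finset.Ioc L (2 * L), ‖a l‖) * (∑ k ∈ Finset.Ioc K (2 * K), ‖b k‖)) ^ 2 :=
        pow_le_pow_left₀ (norm_nonneg _) h1 2
    _ = (∑ l ∈ Finset.Ioc L (2 * L), ‖a l‖) ^ 2 * (∑ k ∈ Finset.Ioc K (2 * K), ‖b k‖) ^ 2 := mul_pow _ _ _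
    _ ≤ (L * ∑ l ∈ Finset.Ioc L (2 * L), ‖a l‖ ^ 2) * (K * ∑ l ∈ Finset.Ioc K (2 * K), ‖b l‖ ^ 2) :=
        mul_le_mul (hc L a) (hc K b) (by positivity) (by positivity)
    _ = _ := by ring

/-- **Lemma 6.3 of the paper (bilinear estimate).** Let `K, L ∈ ℕ`, `m ≠ 0` with
`|m| min{K,L} ≤ σ(KL) φ(KL)` and `φ(KL) ≤ min{K,L}⁴`, and let `Δ₁, Δ₂` satisfy
`∑_{L < l ≤ 2L} |Δ₁(l)|² ≤ D₁ L log³ L` and `∑_{K < k ≤ 2K} |Δ₂(k)|² ≤ D₂ K log³ K`.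
Then `|∑_{L < l ≤ L'} ∑_{K < k ≤ K', P < kl ≤ P₁} Δ₁(l)Δ₂(k) e(αkl + mφ(kl))|
  ≲ |m|^{1/6} log² L log² K (σ(KL)φ(KL))^{-1/6} min{K,L}^{1/6} KL`. -/
theorem bilinear_exponential_sum_bound {c : ℝ} (hc₁ : 1 ≤ c) (hc₂ : c < 16 / 15) (F : Fc c)
    (φ : ℝ → ℝ) (hφ₁ : ∀ x ≥ F.x₀, φ (F.toFun x) = x)
    (hφ₂ : ∀ y ≥ F.toFun F.x₀, F.toFun (φ y) = y)
    (hφ₃ : ∀ y ≥ F.toFun F.x₀, F.x₀ ≤ φ y)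
    (D₁ D₂ : ℝ) (hD₁ : 0 < D₁) (hD₂ : 0 < D₂) :
    ∃ C > 0, ∀ K L : ℕ, 1 ≤ K → 1 ≤ L → ∀ m : ℤ, m ≠ 0 →
      |(m : ℝ)| * min (K : ℝ) (L : ℝ) ≤ sigmah F φ ((K : ℝ) * L) * φ ((K : ℝ) * L) →
      φ ((K : ℝ) * L) ≤ min (K : ℝ) (L : ℝ) ^ 4 →
      ∀ Δ₁ Δ₂ : ℕ → ℂ,
      (∑ l ∈ Finset.Ioc L (2 * L), ‖Δ₁ l‖ ^ 2 ≤ D₁ * L * Real.log L ^ 3) →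
      (∑ k ∈ Finset.Ioc K (2 * K), ‖Δ₂ k‖ ^ 2 ≤ D₂ * K * Real.log K ^ 3) →
      ∀ α P P₁ : ℝ, 0 < P → P < P₁ →
      ∀ L' : ℕ, L < L' → L' ≤ 2 * L → ∀ K' : ℕ, K < K' → K' ≤ 2 * K →
      ‖∑ l ∈ Finset.Ioc L L',
          ∑ k ∈ (Finset.Ioc K K').filter (fun k : ℕ => P < (k : ℝ) * l ∧ (k : ℝ) * l ≤ P₁),
            Δ₁ l * Δ₂ k * e (α * k * l + (m : ℝ) * φ ((k : ℝ) * l))‖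
      ≤ C * |(m : ℝ)| ^ ((1 : ℝ) / 6) * Real.log L ^ 2 * Real.log K ^ 2 *
          (sigmah F φ ((K : ℝ) * L) * φ ((K : ℝ) * L)) ^ (-(1 : ℝ) / 6) *
          min (K : ℝ) (L : ℝ) ^ ((1 : ℝ) / 6) * ((K : ℝ) * L) := by
  obtain ⟨C, hC, X, hX, hcore⟩ := core hc₁ hc₂ F φ hφ₁ hφ₂ hφ₃
  -- bound for small `KL`
  obtain ⟨Y, hY1, hY⟩ : ∃ Y : ℝ, 1 ≤ Y ∧ ∀ n : ℕ, (n : ℝ) < X → sigmah F φ n * φ n ≤ Y := by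
    refine ⟨1 + ∑ n ∈ Finset.range (⌈X⌉₊ + 1), |sigmah F φ n * φ n|, ?_, ?_⟩
    · have : 0 ≤ ∑ n ∈ Finset.range (⌈X⌉₊ + 1), |sigmah F φ n * φ n| := by positivity
      linarith
    · intro n hn
      have hmem : n ∈ Finset.range (⌈X⌉₊ + 1) := by
        rw [Finset.mem_range]
        have := Nat.le_ceil X
        have : (n : ℝ) < ⌈X⌉₊ := by linarith
        have : n < ⌈X⌉₊ := by exact_mod_cast this
        omega
      have h1 := Finset.single_le_sum (f := fun n : ℕ => |sigmah F φ n * φ n|) (fun i _ => abs_nonneg _) hmem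
      linarith [le_abs_self (sigmah F φ n * φ n)]
  have hl2 : 0 < Real.log 2 := Real.log_pos (by norm_num)
  set C' := (C + Y) * (D₁ * D₂) / Real.log 2 ^ 2 with hC'
  have hC'0 : 0 < C' := by positivity
  refine ⟨√C', Real.sqrt_pos.2 hC'0, ?_⟩
  intro K L hK hL m hm hmW hphi Δ₁ Δ₂ hE1 hE2 α P P₁ hP hPP L' hL' hL'2 K' hK' hK'2
  have hK0 : (0 : ℝ) < K := by exact_mod_cast hK
  have hL0 : (0 : ℝ) < L := by exact_mod_cast hL
  have hm1 : 1 ≤ |(m : ℝ)| := by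
    have := Int.one_le_abs hm
    exact_mod_cast this
  have hM1 : (1 : ℝ) ≤ min (K : ℝ) L := le_min (by exact_mod_cast hK) (by exact_mod_cast hL)
  have hmM1 : 1 ≤ |(m : ℝ)| * min (K : ℝ) L := by nlinarith
  obtain ⟨p, hp⟩ : ∃ p : ℕ → ℕ → Prop, ∀ l k, p l k ↔
      (l ≤ L' ∧ k ≤ K' ∧ P < (k : ℝ) * l ∧ (k : ℝ) * l ≤ P₁) := ⟨_, fun _ _ => Iff.rfl⟩
  set w : ℕ → ℕ → ℂ := fun l k => if p l k then e (α * k * l + (m : ℝ) * φ ((k : ℝ) * l)) else 0 with hw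
  have hS : ∑ l ∈ Finset.Ioc L L',
          ∑ k ∈ (Finset.Ioc K K').filter (fun k : ℕ => P < (k : ℝ) * l ∧ (k : ℝ) * l ≤ P₁),
            Δ₁ l * Δ₂ k * e (α * k * l + (m : ℝ) * φ ((k : ℝ) * l)) =
      ∑ l ∈ Finset.Ioc L (2 * L), ∑ k ∈ Finset.Ioc K (2 * K),
        if p l k then Δ₁ l * Δ₂ k * e (α * k * l + (m : ℝ) * φ ((k : ℝ) * l)) else 0 := by
    have e1 : Finset.Ioc L L' = (Finset.Ioc L (2 * L)).filter (fun l => l ≤ L') := by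
      ext l; simp only [Finset.mem_Ioc, Finset.mem_filter]; omega
    have e2 : Finset.Ioc K K' = (Finset.Ioc K (2 * K)).filter (fun l => l ≤ K') := by
      ext l; simp only [Finset.mem_Ioc, Finset.mem_filter]; omega
    rw [e1, Finset.sum_filter]
    refine Finset.sum_congr rfl fun l _ => ?_
    by_cases h : l ≤ L'
    · rw [if_pos h, e2, Finset.filter_filter, Finset.sum_filter]
      refine Finset.sum_congr rfl fun k _ => ?_
      simp only [hp, h, true_and]
    · rw [if_neg h]
      simp [hp, h]
  rw [hS]
  set T := ∑ l ∈ Finset.Ioc L (2 * L), ∑ k ∈ Finset.Ioc K (2 * K),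
        if p l k then Δ₁ l * Δ₂ k * e (α * k * l + (m : ℝ) * φ ((k : ℝ) * l)) else 0 with hT
  set W := sigmah F φ ((K : ℝ) * L) * φ ((K : ℝ) * L) with hW
  have hW0 : 0 < W := by linarith
  set M := min (K : ℝ) (L : ℝ) with hM
  set E1 := ∑ l ∈ Finset.Ioc L (2 * L), ‖Δ₁ l‖ ^ 2 with hE1d
  set E2 := ∑ k ∈ Finset.Ioc K (2 * K), ‖Δ₂ k‖ ^ 2 with hE2d
  have hE10 : 0 ≤ E1 := by positivity
  have hE20 : 0 ≤ E2 := by positivity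
  set R := (|(m : ℝ)| * M / W) ^ ((1 : ℝ) / 3) with hR
  have hR0 : 0 ≤ R := by positivity
  have main : ‖T‖ ^ 2 ≤ (C + Y) * R * (K * L) * (E1 * E2) := by
    rcases lt_or_ge ((K : ℝ) * L) X with hsm | hlg
    · have hWY : W ≤ Y := by
        have := hY (K * L) (by push_cast; exact hsm)
        push_cast at this
        exact this
      have hYR : 1 ≤ Y * R := by
        have h1 : 1 / Y ≤ |(m : ℝ)| * M / W := by
          rw [div_le_div_iff₀ (by linarith) hW0]
          nlinarith
        have h2 : 1 / Y ≤ (1 / Y) ^ ((1 : ℝ) / 3) := by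
          apply Real.self_le_rpow_of_le_one (by positivity)
          · rw [div_le_one (by linarith)]; exact hY1
          · norm_num
        have h3 : (1 / Y) ^ ((1 : ℝ) / 3) ≤ R := Real.rpow_le_rpow (by positivity) h1 (by norm_num)
        have h4 := h2.trans h3
        rw [div_le_iff₀ (by linarith)] at h4
        linarith
      have h5 := triv_bound K L Δ₁ Δ₂ w (by
        intro l k; simp only [hw]; split_ifs
        · rw [norm_e]
        · simp)
      have h6 : T = ∑ l ∈ Finset.Ioc L (2 * L), ∑ k ∈ Finset.Ioc K (2 * K), Δ₁ l * Δ₂ k * w l k := by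
        rw [hT]
        refine Finset.sum_congr rfl fun l _ => Finset.sum_congr rfl fun k _ => ?_
        simp only [hw]; split_ifs <;> simp
      rw [h6]
      refine h5.trans ?_
      have h7 : 1 ≤ (C + Y) * R := by nlinarith [mul_nonneg hC.le hR0]
      have h8 : 0 ≤ (K : ℝ) * L * (E1 * E2) := by positivity
      nlinarith
    · have hCY : C * R * (K * L) * (E1 * E2) ≤ (C + Y) * R * (K * L) * (E1 * E2) := by
        gcongr
        linarith
      refine le_trans ?_ hCY
      rcases le_total (L : ℝ) (K : ℝ) with hLK | hKL
      · have hML : M = L := min_eq_right hLK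
        rw [hML] at hmW hphi
        rw [hR, hML]
        apply hcore K L hK hL hlg m hm hmW hphi Δ₁ Δ₂ α p
        intro l k₁ k₂ k ha hb h1 h2
        obtain ⟨a1, a2, a3, a4⟩ := (hp _ _).1 ha
        obtain ⟨b1, b2, b3, b4⟩ := (hp _ _).1 hb
        have h1' : (k₁ : ℝ) * l ≤ k * l := by gcongr
        have h2' : (k : ℝ) * l ≤ k₂ * l := by gcongr
        exact (hp _ _).2 ⟨a1, h2.trans b2, a3.trans_le h1', h2'.trans b4⟩
      · have hMK : M = K := min_eq_left hKL
        have hcomm : (K : ℝ) * L = (L : ℝ) * K := mul_comm _ _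
        rw [hMK] at hmW hphi
        rw [hR, hMK]
        have hWc : W = sigmah F φ ((L : ℝ) * K) * φ ((L : ℝ) * K) := by rw [hW, hcomm]
        have := hcore L K hL hK (by rw [← hcomm]; exact hlg) m hm (by rw [← hWc]; exact hmW)
          (by rw [← hcomm]; exact hphi) Δ₂ Δ₁ α (fun k l => p l k) (by
            intro k l₁ l₂ l ha hb h1 h2
            obtain ⟨a1, a2, a3, a4⟩ := (hp _ _).1 ha
            obtain ⟨b1, b2, b3, b4⟩ := (hp _ _).1 hb
            have h1' : (k : ℝ) * l₁ ≤ k * l := by gcongr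
            have h2' : (k : ℝ) * l ≤ k * l₂ := by gcongr
            exact (hp _ _).2 ⟨h2.trans b1, a2, a3.trans_le h1', h2'.trans b4⟩)
        rw [← hWc] at this
        rw [hcomm, mul_comm E1 E2]
        refine le_trans (le_of_eq ?_) this
        congr 2
        rw [hT, Finset.sum_comm]
        refine Finset.sum_congr rfl fun k _ => Finset.sum_congr rfl fun l _ => ?_
        rw [show α * (k : ℝ) * l = α * l * k by ring, mul_comm (k : ℝ) (l : ℝ), mul_comm (Δ₁ l) (Δ₂ k)]
  have hRHS : √C' * |(m : ℝ)| ^ ((1 : ℝ) / 6) * Real.log L ^ 2 * Real.log K ^ 2 *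
          W ^ (-(1 : ℝ) / 6) * M ^ ((1 : ℝ) / 6) * ((K : ℝ) * L) =
      √C' * (|(m : ℝ)| * M / W) ^ ((1 : ℝ) / 6) * (Real.log L ^ 2 * Real.log K ^ 2 * ((K : ℝ) * L)) := by
    have h1 : (|(m : ℝ)| * M / W) ^ ((1 : ℝ) / 6) = |(m : ℝ)| ^ ((1 : ℝ) / 6) * M ^ ((1 : ℝ) / 6) * W ^ (-(1 : ℝ) / 6) := by
      rw [Real.div_rpow (by positivity) hW0.le, Real.mul_rpow (by positivity) (by linarith),
        neg_div, Real.rpow_neg hW0.le, div_eq_mul_inv]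
    rw [h1]; ring
  rw [hRHS]
  apply le_of_sq_le_sq _ (by positivity)
  have hR6 : ((|(m : ℝ)| * M / W) ^ ((1 : ℝ) / 6)) ^ 2 = R := by
    rw [← Real.rpow_natCast, ← Real.rpow_mul (by positivity), hR]; norm_num
  rw [mul_pow, mul_pow, Real.sq_sqrt hC'0.le, hR6]
  refine main.trans ?_
  have hlogL := log_ineq L hL
  have hlogK := log_ineq K hK
  have hlL : 0 ≤ Real.log L := Real.log_natCast_nonneg L
  have hlK : 0 ≤ Real.log K := Real.log_natCast_nonneg K
  have g1 : E1 ≤ D₁ * L * (Real.log L ^ 4 / Real.log 2) := hE1.trans (by gcongr)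
  have g2 : E2 ≤ D₂ * K * (Real.log K ^ 4 / Real.log 2) := hE2.trans (by gcongr)
  calc (C + Y) * R * (K * L) * (E1 * E2) ≤ (C + Y) * R * (K * L) *
        ((D₁ * L * (Real.log L ^ 4 / Real.log 2)) * (D₂ * K * (Real.log K ^ 4 / Real.log 2))) := by
        gcongr
    _ = _ := by rw [hC']; field_simp
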